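/- arXiv:2602.12213 — 4 statements merged into one kernel-verified Lean document; each statement's English description precedes it below -/
import Mathlib

section
/- Let K be a field of characteristic different from 2, let c ∈ K and f = x² + c ∈ K[x]. Define the adjusted post-critical orbit by c₁ = −c and c_{n+1} = f(c_n) for n ≥ 1, and assume c_n ≠ 0 for every n ≥ 1. Then the splitting field K_n(f) of f^n over K satisfies [K_n(f) : K] = 2^(2^n − 1) for every n ≥ 1 (i.e. the dynamical Galois group of f is the full automorphism group of the infinite rooted binary tree) if and only if the classes of c₁, c₂, c₃, … in K^×/(K^×)² are linearly independent over 𝔽₂, i.e. if and only if for every nonempty finite subset S of ℤ_{≥1} the product ∏_{n∈S} c_n is not a square in K. -/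
open Polynomial

/-- The `n`-fold composition `f^n` of a polynomial with itself, with `f^0 = X`. -/
noncomputable def polyIter {K : Type*} [Field K] (f : K[X]) : ℕ → K[X]
  | 0 => X
  | n + 1 => f.comp (polyIter f n)

section StollCriterion

open IntermediateField
open scoped Pointwise symmDiff

section Multiquadratic

variable {K Ω : Type*} [Field K] [Field Ω] [Algebra K Ω]

theorem mem_iff_forall_fixingSubgroup [IsGalois K Ω] (E : IntermediateField K Ω) (x : Ω) :
    x ∈ E ↔ ∀ σ ∈ E.fixingSubgroup, σ x = x := by
  conv_lhs => rw [← InfiniteGalois.fixedField_fixingSubgroup E]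
  simp [IntermediateField.mem_fixedField_iff]

theorem mem_fixingSubgroup_sup_adjoin_simple {E : IntermediateField K Ω} {b : Ω}
    {σ : Gal(Ω/K)} (hσ : σ ∈ E.fixingSubgroup) (hb : σ b = b) :
    σ ∈ (E ⊔ K⟮b⟯).fixingSubgroup := by
  rw [fixingSubgroup_sup]
  refine Subgroup.mem_inf.2 ⟨hσ, ?_⟩
  rw [IntermediateField.mem_fixingSubgroup_iff]
  have := (forall_mem_adjoin_smul_eq_self_iff K (S := {b}) σ).2 (by simpa using hb)
  simpa using this

theorem eq_or_eq_neg_of_sq_mem {E : IntermediateField K Ω} {b : Ω} (hb : b ^ 2 ∈ E)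
    {σ : Gal(Ω/K)} (hσ : σ ∈ E.fixingSubgroup) : σ b = b ∨ σ b = -b := by
  rw [IntermediateField.mem_fixingSubgroup_iff] at hσ
  rw [← sq_eq_sq_iff_eq_or_eq_neg, ← map_pow]
  exact hσ _ hb

/-- Kummer theory for a single square root. -/
theorem mem_or_mul_mem_of_sq_mem [IsGalois K Ω] {E : IntermediateField K Ω} {b y : Ω}
    (hb : b ^ 2 ∈ E) (hy : y ^ 2 ∈ E) (h : y ∈ E ⊔ K⟮b⟯) : y ∈ E ∨ y * b ∈ E := by
  rw [mem_iff_forall_fixingSubgroup] at h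
  by_cases hyE : y ∈ E
  · exact .inl hyE
  right
  rw [mem_iff_forall_fixingSubgroup] at hyE ⊢
  push Not at hyE
  obtain ⟨σ, hσ, hσy⟩ := hyE
  have hσy' := (eq_or_eq_neg_of_sq_mem hy hσ).resolve_left hσy
  have hσb : σ b = -b := (eq_or_eq_neg_of_sq_mem hb hσ).resolve_left fun hb' ↦
    hσy (h σ (mem_fixingSubgroup_sup_adjoin_simple hσ hb'))
  intro τ hτ
  rcases eq_or_eq_neg_of_sq_mem hb hτ with hτb | hτb
  · rw [map_mul, hτb, h τ (mem_fixingSubgroup_sup_adjoin_simple hτ hτb)]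
  · have key : (σ * τ) y = y :=
      h _ (mem_fixingSubgroup_sup_adjoin_simple (mul_mem hσ hτ) (by simp [hτb, hσb]))
    have hτy : τ y = -y := by
      apply σ.injective
      simpa [hσy'] using key
    rw [map_mul, hτb, hτy, neg_mul_neg]

theorem sup_adjoin_image_empty (E : IntermediateField K Ω) (b : Ω → Ω) :
    E ⊔ adjoin K (b '' ↑(∅ : Finset Ω)) = E := by
  simp

theorem sup_adjoin_image_insert [DecidableEq Ω] (E : IntermediateField K Ω) (b : Ω → Ω) (i : Ω)
    (S : Finset Ω) :
    E ⊔ adjoin K (b '' ↑(insert i S)) = (E ⊔ adjoin K (b '' ↑S)) ⊔ K⟮b i⟯ := by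
  rw [Finset.coe_insert, Set.image_insert_eq, Set.insert_eq, adjoin_union, sup_assoc,
    sup_comm K⟮b i⟯]

theorem apply_mem_sup_adjoin_image (E : IntermediateField K Ω) (b : Ω → Ω) {i : Ω}
    {S : Finset Ω} (hi : i ∈ S) : b i ∈ E ⊔ adjoin K (b '' ↑S) :=
  (le_sup_right : _ ≤ E ⊔ adjoin K (b '' ↑S)) (subset_adjoin K _ ⟨i, hi, rfl⟩)

/-- Kummer theory for finitely many square roots. -/
theorem exists_mul_prod_mem_of_sq_mem [IsGalois K Ω] {E : IntermediateField K Ω} (b : Ω → Ω)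
    (S : Finset Ω) (hb : ∀ i ∈ S, b i ^ 2 ∈ E) {y : Ω} (hy : y ^ 2 ∈ E)
    (h : y ∈ E ⊔ adjoin K (b '' ↑S)) : ∃ T ⊆ S, y * ∏ i ∈ T, b i ∈ E := by
  classical
  induction S using Finset.induction_on generalizing y with
  | empty => exact ⟨∅, by simp, by simpa using h⟩
  | insert i S hi ih =>
    rw [sup_adjoin_image_insert] at h
    have hle : E ≤ E ⊔ adjoin K (b '' ↑S) := le_sup_left
    have hbi := hb i (Finset.mem_insert_self i S)
    have hbS : ∀ j ∈ S, b j ^ 2 ∈ E := fun j hj ↦ hb j (Finset.mem_insert_of_mem hj)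
    rcases mem_or_mul_mem_of_sq_mem (hle hbi) (hle hy) h with h | h
    · obtain ⟨T, hT, hm⟩ := ih hbS hy h
      exact ⟨T, hT.trans (Finset.subset_insert i S), hm⟩
    · obtain ⟨T, hT, hm⟩ := ih hbS (by rw [mul_pow]; exact mul_mem hy hbi) h
      refine ⟨insert i T, Finset.insert_subset_insert i hT, ?_⟩
      rwa [Finset.prod_insert fun h ↦ hi (hT h), ← mul_assoc]

open scoped Classical in
theorem finrank_sup_adjoin_simple_of_sq_mem {E : IntermediateField K Ω} {b : Ω}
    (hb : b ^ 2 ∈ E) :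
    Module.finrank K ↥(E ⊔ K⟮b⟯) = Module.finrank K E * if b ∈ E then 1 else 2 := by
  have h1 : Module.finrank E E⟮b⟯ = if b ∈ E then 1 else 2 := by
    have hmonic : (X ^ 2 - C (⟨b ^ 2, hb⟩ : E)).Monic := monic_X_pow_sub_C _ two_ne_zero
    have hroot : aeval b (X ^ 2 - C (⟨b ^ 2, hb⟩ : E)) = 0 := by simp
    have hint : IsIntegral E b := ⟨_, hmonic, hroot⟩
    have hle : Module.finrank E E⟮b⟯ ≤ 2 := by
      rw [adjoin.finrank hint]
      exact (natDegree_le_of_dvd (minpoly.dvd E b hroot) hmonic.ne_zero).trans_eq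
        (natDegree_X_pow_sub_C)
    have hpos : 0 < Module.finrank E E⟮b⟯ := by
      rw [adjoin.finrank hint]
      exact minpoly.natDegree_pos hint
    have hone : Module.finrank E E⟮b⟯ = 1 ↔ b ∈ E := by
      rw [finrank_adjoin_simple_eq_one_iff, IntermediateField.mem_bot]
      simp
    split_ifs with h
    · exact hone.2 h
    · have := mt hone.1 h
      omega
  rw [← h1, ← restrictScalars_adjoin_eq_sup]
  exact (Module.finrank_mul_finrank K E E⟮b⟯).symm

theorem finrank_sup_adjoin_image_le {E : IntermediateField K Ω} (b : Ω → Ω)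
    (S : Finset Ω) (hb : ∀ i ∈ S, b i ^ 2 ∈ E) :
    Module.finrank K ↥(E ⊔ adjoin K (b '' ↑S)) ≤ Module.finrank K E * 2 ^ S.card := by
  classical
  induction S using Finset.induction_on with
  | empty => rw [sup_adjoin_image_empty, Finset.card_empty, pow_zero, mul_one]
  | insert i S hi ih =>
    rw [sup_adjoin_image_insert, finrank_sup_adjoin_simple_of_sq_mem
      ((le_sup_left : E ≤ _) (hb i (Finset.mem_insert_self i S))), Finset.card_insert_of_notMem hi,
      pow_succ, ← mul_assoc]
    exact Nat.mul_le_mul (ih fun j hj ↦ hb j (Finset.mem_insert_of_mem hj)) (by split_ifs <;> simp)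

theorem finrank_sup_adjoin_image_eq_iff [IsGalois K Ω] {E : IntermediateField K Ω}
    (hE : Module.finrank K E ≠ 0) (b : Ω → Ω)
    (S : Finset Ω) (hb : ∀ i ∈ S, b i ^ 2 ∈ E) (hb0 : ∀ i ∈ S, b i ≠ 0) :
    Module.finrank K ↥(E ⊔ adjoin K (b '' ↑S)) = Module.finrank K E * 2 ^ S.card ↔
      ∀ T ⊆ S, T.Nonempty → ∏ i ∈ T, b i ∉ E := by
  classical
  induction S using Finset.induction_on with
  | empty =>
    rw [sup_adjoin_image_empty]
    simp +contextual [Finset.subset_empty, Finset.nonempty_iff_ne_empty]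
  | insert i S hi ih =>
    have hbS : ∀ j ∈ S, b j ^ 2 ∈ E := fun j hj ↦ hb j (Finset.mem_insert_of_mem hj)
    have hle : E ≤ E ⊔ adjoin K (b '' ↑S) := le_sup_left
    have hbi := hb i (Finset.mem_insert_self i S)
    specialize ih hbS fun j hj ↦ hb0 j (Finset.mem_insert_of_mem hj)
    have hbound := finrank_sup_adjoin_image_le b S hbS
    have hpos : 0 < Module.finrank K E * 2 ^ S.card := by positivity
    rw [sup_adjoin_image_insert, finrank_sup_adjoin_simple_of_sq_mem (hle hbi),
      Finset.card_insert_of_notMem hi, pow_succ, ← mul_assoc]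
    constructor
    · intro h
      have hiS : b i ∉ E ⊔ adjoin K (b '' ↑S) := by
        intro hmem
        rw [if_pos hmem] at h
        omega
      rw [if_neg hiS] at h
      have hind := ih.1 (by omega)
      intro T hT hne hmem
      by_cases hiT : i ∈ T
      · rw [← Finset.mul_prod_erase T b hiT] at hmem
        have hTS : T.erase i ⊆ S := Finset.subset_insert_iff.1 hT
        refine hiS ?_
        have h1 : ∏ j ∈ T.erase i, b j ∈ E ⊔ adjoin K (b '' ↑S) :=
          prod_mem fun j hj ↦ apply_mem_sup_adjoin_image E b (hTS hj)
        have h2 : ∏ j ∈ T.erase i, b j ≠ 0 :=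
          Finset.prod_ne_zero_iff.2 fun j hj ↦ hb0 j (Finset.mem_insert_of_mem (hTS hj))
        rw [← mul_div_cancel_right₀ (b i) h2]
        exact div_mem (hle hmem) h1
      · exact hind T ((Finset.subset_insert_iff_of_notMem hiT).1 hT) hne hmem
    · intro hind
      rw [ih.2 fun T hT ↦ hind T (hT.trans (Finset.subset_insert i S)), if_neg]
      intro hmem
      obtain ⟨T, hT, hm⟩ := exists_mul_prod_mem_of_sq_mem b S hbS hbi hmem
      rw [← Finset.prod_insert fun h ↦ hi (hT h)] at hm
      exact hind _ (Finset.insert_subset_insert i hT) (Finset.insert_nonempty i T) hm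

theorem exists_smul_eq_self_of_sq_mem [DecidableEq Ω] {V : Finset Ω → Prop}
    (hadd : ∀ T U, V T → V U → V (T ∆ U)) (hsmul : ∀ (σ : Gal(Ω/K)) T, V T → V (σ • T))
    {E : IntermediateField K Ω} {b : Ω} (hb : b ^ 2 ∈ E)
    (h : ∃ T, V T ∧ T.Nonempty ∧ ∀ σ ∈ (E ⊔ K⟮b⟯).fixingSubgroup, σ • T = T) :
    ∃ T, V T ∧ T.Nonempty ∧ ∀ σ ∈ E.fixingSubgroup, σ • T = T := by
  obtain ⟨T, hT, hne, hfix⟩ := h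
  by_cases hall : ∀ σ ∈ E.fixingSubgroup, σ • T = T
  · exact ⟨T, hT, hne, hall⟩
  push Not at hall
  obtain ⟨σ, hσ, hσT⟩ := hall
  have hσb : σ b = -b := (eq_or_eq_neg_of_sq_mem hb hσ).resolve_left fun hb' ↦
    hσT (hfix σ (mem_fixingSubgroup_sup_adjoin_simple hσ hb'))
  have hσb' : σ⁻¹ b = -b := by
    apply σ.injective
    rw [map_neg, hσb, neg_neg, ← AlgEquiv.mul_apply, mul_inv_cancel, AlgEquiv.one_apply]
  refine ⟨T ∆ (σ • T), hadd _ _ hT (hsmul σ T hT), ?_, fun τ hτ ↦ ?_⟩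
  · rw [Finset.nonempty_iff_ne_empty, ← Finset.bot_eq_empty, Ne, symmDiff_eq_bot]
    exact fun h ↦ hσT h.symm
  rw [Finset.smul_finset_symmDiff, smul_smul]
  rcases eq_or_eq_neg_of_sq_mem hb hτ with hτb | hτb
  · have h1 : (σ⁻¹ * (τ * σ)) • T = T :=
      hfix _ (mem_fixingSubgroup_sup_adjoin_simple (mul_mem (inv_mem hσ) (mul_mem hτ hσ))
        (by simp only [AlgEquiv.mul_apply, hσb, hσb', map_neg, hτb, neg_neg]))
    rw [hfix τ (mem_fixingSubgroup_sup_adjoin_simple hτ hτb)]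
    rw [mul_smul, inv_smul_eq_iff] at h1
    rw [h1]
  · have h1 : (σ⁻¹ * τ) • T = T :=
      hfix _ (mem_fixingSubgroup_sup_adjoin_simple (mul_mem (inv_mem hσ) hτ)
        (by simp only [AlgEquiv.mul_apply, hσb', map_neg, hτb, neg_neg]))
    have h2 : (τ * σ) • T = T :=
      hfix _ (mem_fixingSubgroup_sup_adjoin_simple (mul_mem hτ hσ)
        (by simp only [AlgEquiv.mul_apply, hσb, map_neg, hτb, neg_neg]))
    rw [mul_smul, inv_smul_eq_iff] at h1
    rw [h1, h2, symmDiff_comm]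

theorem exists_smul_eq_self_of_sup_adjoin_image [DecidableEq Ω] {V : Finset Ω → Prop}
    (hadd : ∀ T U, V T → V U → V (T ∆ U)) (hsmul : ∀ (σ : Gal(Ω/K)) T, V T → V (σ • T))
    {E : IntermediateField K Ω} (b : Ω → Ω) (S : Finset Ω) (hb : ∀ i ∈ S, b i ^ 2 ∈ E)
    (h : ∃ T, V T ∧ T.Nonempty ∧ ∀ σ ∈ (E ⊔ adjoin K (b '' ↑S)).fixingSubgroup, σ • T = T) :
    ∃ T, V T ∧ T.Nonempty ∧ ∀ σ ∈ E.fixingSubgroup, σ • T = T := by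
  induction S using Finset.induction_on with
  | empty => simpa using h
  | insert i S hi ih =>
    rw [sup_adjoin_image_insert] at h
    exact ih (fun j hj ↦ hb j (Finset.mem_insert_of_mem hj)) (exists_smul_eq_self_of_sq_mem
      hadd hsmul ((le_sup_left : E ≤ _) (hb i (Finset.mem_insert_self i S))) h)

theorem prod_mul_prod_eq_prod_symmDiff_mul {ι M : Type*} [DecidableEq ι] [CommMonoid M]
    (T U : Finset ι) (b : ι → M) :
    (∏ i ∈ T, b i) * ∏ i ∈ U, b i = (∏ i ∈ T ∆ U, b i) * (∏ i ∈ T ∩ U, b i) ^ 2 := by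
  have hdisj : Disjoint (T ∆ U) (T ∩ U) := disjoint_symmDiff_inf T U
  have hunion : T ∆ U ∪ T ∩ U = T ∪ U := symmDiff_sup_inf T U
  rw [← Finset.prod_union_inter, sq, ← mul_assoc, ← Finset.prod_union hdisj, hunion]

end Multiquadratic

section IteratedPreimages

variable {K Ω : Type*} [Field K] [Field Ω] [Algebra K Ω] [DecidableEq Ω]

/-- The `n`-fold iterated preimages of `0` under `x ^ 2 + c`, for a function `s` choosing square
roots `s r` of `r - c`. -/
def iterRoots (s : Ω → Ω) : ℕ → Finset Ω
  | 0 => {0}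
  | n + 1 => (iterRoots s n).image s ∪ (iterRoots s n).image (fun r ↦ -s r)

theorem iterRoots_nonempty (s : Ω → Ω) (n : ℕ) : (iterRoots s n).Nonempty := by
  induction n with
  | zero => exact Finset.singleton_nonempty 0
  | succ n ih => exact (ih.image s).mono Finset.subset_union_left

variable (K) in
/-- The subfield generated by the `n`-fold iterated preimages of `0`. -/
def iterField (s : Ω → Ω) (n : ℕ) : IntermediateField K Ω :=
  adjoin K (iterRoots s n : Set Ω)

variable {c : K} {s : Ω → Ω}

theorem mem_iterRoots_succ (hs : ∀ r, s r ^ 2 = r - algebraMap K Ω c) {n : ℕ} {x : Ω} :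
    x ∈ iterRoots s (n + 1) ↔ x ^ 2 + algebraMap K Ω c ∈ iterRoots s n := by
  simp only [iterRoots, Finset.mem_union, Finset.mem_image]
  constructor
  · rintro (⟨r, hr, rfl⟩ | ⟨r, hr, rfl⟩)
    · rwa [hs, sub_add_cancel]
    · rwa [neg_sq, hs, sub_add_cancel]
  · intro h
    have h1 : s (x ^ 2 + algebraMap K Ω c) ^ 2 = x ^ 2 := by rw [hs, add_sub_cancel_right]
    rcases sq_eq_sq_iff_eq_or_eq_neg.1 h1 with h2 | h2
    · exact .inl ⟨_, h, h2⟩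
    · exact .inr ⟨_, h, by rw [h2, neg_neg]⟩

theorem map_mem_iterRoots (hs : ∀ r, s r ^ 2 = r - algebraMap K Ω c) (σ : Gal(Ω/K)) {n : ℕ}
    {x : Ω} (hx : x ∈ iterRoots s n) : σ x ∈ iterRoots s n := by
  induction n generalizing x with
  | zero => simp_all [iterRoots]
  | succ n ih =>
    rw [mem_iterRoots_succ hs] at hx ⊢
    simpa using ih hx

theorem smul_subset_iterRoots (hs : ∀ r, s r ^ 2 = r - algebraMap K Ω c) (σ : Gal(Ω/K)) {n : ℕ}
    {T : Finset Ω} (hT : T ⊆ iterRoots s n) : σ • T ⊆ iterRoots s n := by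
  intro x hx
  obtain ⟨y, hy, rfl⟩ := Finset.mem_smul_finset.1 hx
  exact map_mem_iterRoots hs σ (hT hy)

theorem mem_iterField {n : ℕ} {x : Ω} (hx : x ∈ iterRoots s n) : x ∈ iterField K s n :=
  subset_adjoin K _ hx

theorem map_mem_iterField (hs : ∀ r, s r ^ 2 = r - algebraMap K Ω c) (σ : Gal(Ω/K)) {n : ℕ}
    {x : Ω} (hx : x ∈ iterField K s n) : σ x ∈ iterField K s n := by
  have : iterField K s n ≤ (iterField K s n).comap (σ : Ω →ₐ[K] Ω) :=
    adjoin_le_iff.2 fun y hy ↦ mem_iterField (map_mem_iterRoots hs σ hy)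
  exact this hx

theorem sqrt_mem_iterRoots_succ {n : ℕ} {r : Ω} (hr : r ∈ iterRoots s n) :
    s r ∈ iterRoots s (n + 1) :=
  Finset.mem_union_left _ (Finset.mem_image_of_mem s hr)

theorem iterField_zero : iterField K s 0 = ⊥ := by
  simp [iterField, iterRoots]

theorem sqrt_sq_mem_iterField (hs : ∀ r, s r ^ 2 = r - algebraMap K Ω c) {n : ℕ} {r : Ω}
    (hr : r ∈ iterRoots s n) : s r ^ 2 ∈ iterField K s n := by
  rw [hs]
  exact sub_mem (mem_iterField hr) (IntermediateField.algebraMap_mem _ c)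

theorem iterField_succ (hs : ∀ r, s r ^ 2 = r - algebraMap K Ω c) (n : ℕ) :
    iterField K s (n + 1) = iterField K s n ⊔ adjoin K (s '' ↑(iterRoots s n)) := by
  refine le_antisymm (adjoin_le_iff.2 fun x hx ↦ ?_) (sup_le ?_ ?_)
  · simp only [iterRoots, Finset.mem_coe, Finset.mem_union, Finset.mem_image] at hx
    obtain ⟨r, hr, rfl⟩ | ⟨r, hr, rfl⟩ := hx
    · exact apply_mem_sup_adjoin_image _ s hr
    · exact neg_mem (apply_mem_sup_adjoin_image _ s hr)
  · refine adjoin_le_iff.2 fun r hr ↦ ?_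
    have h := pow_mem (mem_iterField (K := K) (sqrt_mem_iterRoots_succ (s := s) hr)) 2
    rw [hs] at h
    exact (sub_add_cancel r (algebraMap K Ω c)) ▸
      add_mem h (IntermediateField.algebraMap_mem _ c)
  · rw [adjoin_le_iff]
    rintro _ ⟨r, hr, rfl⟩
    exact mem_iterField (sqrt_mem_iterRoots_succ hr)

theorem iterField_mono (hs : ∀ r, s r ^ 2 = r - algebraMap K Ω c) : Monotone (iterField K s) :=
  monotone_nat_of_le_succ fun n ↦ by
    rw [iterField_succ hs]
    exact le_sup_left

theorem prod_sqrt_mem_iterField_succ {n : ℕ} {T : Finset Ω} (hT : T ⊆ iterRoots s n) :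
    ∏ r ∈ T, s r ∈ iterField K s (n + 1) :=
  prod_mem fun _ hr ↦ mem_iterField (sqrt_mem_iterRoots_succ (hT hr))

theorem map_prod_sqrt (hs : ∀ r, s r ^ 2 = r - algebraMap K Ω c) (σ : Gal(Ω/K)) (T : Finset Ω) :
    σ (∏ r ∈ T, s r) = ∏ r ∈ σ • T, s r ∨ σ (∏ r ∈ T, s r) = -∏ r ∈ σ • T, s r := by
  rw [← sq_eq_sq_iff_eq_or_eq_neg, Finset.smul_finset_def,
    Finset.prod_image (MulAction.injective σ).injOn, map_prod, ← Finset.prod_pow,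
    ← Finset.prod_pow]
  refine Finset.prod_congr rfl fun r _ ↦ ?_
  rw [← map_pow, hs, hs]
  simp

/-- The field generated by the `n`-fold preimages contains no nonempty product of the square roots
generating the next level. -/
def IndependentAt (K : Type*) [Field K] [Algebra K Ω] (s : Ω → Ω) (n : ℕ) : Prop :=
  ∀ T ⊆ iterRoots s n, T.Nonempty → ∏ r ∈ T, s r ∉ iterField K s n

/-- The Galois group acts transitively on the `n`-fold preimages. -/
def TransitiveAt (K : Type*) [Field K] [Algebra K Ω] (s : Ω → Ω) (n : ℕ) : Prop :=
  ∀ r ∈ iterRoots s n, ∀ r' ∈ iterRoots s n, ∃ σ : Gal(Ω/K), σ r = r'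

theorem TransitiveAt.succ [IsGalois K Ω] (hs : ∀ r, s r ^ 2 = r - algebraMap K Ω c) {n : ℕ}
    (ht : TransitiveAt K s n) (hi : IndependentAt K s n) : TransitiveAt K s (n + 1) := by
  intro x hx y hy
  have hx' := (mem_iterRoots_succ hs).1 hx
  have hy' := (mem_iterRoots_succ hs).1 hy
  obtain ⟨σ, hσ⟩ := ht _ hx' _ hy'
  have hsq : (σ x) ^ 2 = y ^ 2 := by simpa using hσ
  rcases sq_eq_sq_iff_eq_or_eq_neg.1 hsq with h | h
  · exact ⟨σ, h⟩
  have hyE : y ∉ iterField K s n := by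
    intro hmem
    have h1 := hi {y ^ 2 + algebraMap K Ω c} (by simpa using hy') (Finset.singleton_nonempty _)
    rw [Finset.prod_singleton] at h1
    have h2 : s (y ^ 2 + algebraMap K Ω c) ^ 2 = y ^ 2 := by rw [hs, add_sub_cancel_right]
    rcases sq_eq_sq_iff_eq_or_eq_neg.1 h2 with h2 | h2
    · exact h1 (by rwa [h2])
    · exact h1 (by rw [h2]; exact neg_mem hmem)
  rw [mem_iff_forall_fixingSubgroup] at hyE
  push Not at hyE
  obtain ⟨τ, hτ, hτy⟩ := hyE
  have hy2 : y ^ 2 ∈ iterField K s n := by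
    have := sub_mem (mem_iterField (K := K) hy') (IntermediateField.algebraMap_mem _ c)
    rwa [add_sub_cancel_right] at this
  refine ⟨τ * σ, ?_⟩
  rw [AlgEquiv.mul_apply, h, map_neg, (eq_or_eq_neg_of_sq_mem hy2 hτ).resolve_left hτy, neg_neg]

theorem sqrt_ne_zero (hs : ∀ r, s r ^ 2 = r - algebraMap K Ω c) {n : ℕ}
    (hc : algebraMap K Ω c ∉ iterRoots s n) {r : Ω} (hr : r ∈ iterRoots s n) : s r ≠ 0 := by
  intro h
  have h1 := hs r
  rw [h, zero_pow two_ne_zero, eq_comm, sub_eq_zero] at h1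
  exact hc (h1 ▸ hr)

theorem prod_sqrt_symmDiff_mem (hs : ∀ r, s r ^ 2 = r - algebraMap K Ω c) {n : ℕ}
    (hc : algebraMap K Ω c ∉ iterRoots s n) {T U : Finset Ω} (hT : T ⊆ iterRoots s n)
    (h : (∏ r ∈ T, s r) * ∏ r ∈ U, s r ∈ iterField K s n) :
    ∏ r ∈ T ∆ U, s r ∈ iterField K s n := by
  have hsub : T ∩ U ⊆ iterRoots s n := Finset.inter_subset_left.trans hT
  have h0 : (∏ r ∈ T ∩ U, s r) ^ 2 ≠ 0 :=
    pow_ne_zero 2 (Finset.prod_ne_zero_iff.2 fun r hr ↦ sqrt_ne_zero hs hc (hsub hr))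
  rw [← mul_div_cancel_right₀ (∏ r ∈ T ∆ U, s r) h0, ← prod_mul_prod_eq_prod_symmDiff_mul]
  refine div_mem h ?_
  rw [← Finset.prod_pow]
  exact prod_mem fun r hr ↦ sqrt_sq_mem_iterField hs (hsub hr)

theorem eq_empty_or_eq_iterRoots {n : ℕ} (ht : TransitiveAt K s n) {T : Finset Ω}
    (hT : T ⊆ iterRoots s n) (hfix : ∀ σ : Gal(Ω/K), σ • T = T) : T = ∅ ∨ T = iterRoots s n := by
  rcases T.eq_empty_or_nonempty with h | ⟨r, hr⟩
  · exact .inl h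
  refine .inr (hT.antisymm fun r' hr' ↦ ?_)
  obtain ⟨σ, rfl⟩ := ht r (hT hr) r' hr'
  rw [← hfix σ]
  exact Finset.smul_mem_smul_finset hr

/-- If the product of all square roots at level `n` is not in the `n`-th field, then neither is any
nonempty subproduct. -/
theorem independentAt_of_prod_notMem [IsGalois K Ω]
    (hs : ∀ r, s r ^ 2 = r - algebraMap K Ω c) {n : ℕ}
    (hc : algebraMap K Ω c ∉ iterRoots s n) (ht : TransitiveAt K s n)
    (h : ∏ r ∈ iterRoots s n, s r ∉ iterField K s n) : IndependentAt K s n := by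
  intro T₀ hT₀ hne₀ hmem₀
  let V : Finset Ω → Prop := fun T ↦ T ⊆ iterRoots s n ∧ ∏ r ∈ T, s r ∈ iterField K s n
  have hadd : ∀ T U, V T → V U → V (T ∆ U) := fun T U hT hU ↦
    ⟨(Finset.symmDiff_subset_union).trans (Finset.union_subset hT.1 hU.1),
      prod_sqrt_symmDiff_mem hs hc hT.1 (mul_mem hT.2 hU.2)⟩
  have hsmul : ∀ (σ : Gal(Ω/K)) T, V T → V (σ • T) := by
    refine fun σ T hT ↦ ⟨smul_subset_iterRoots hs σ hT.1, ?_⟩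
    have hσ := map_mem_iterField hs σ hT.2
    rcases map_prod_sqrt hs σ T with h | h
    · rwa [← h]
    · rwa [h, neg_mem_iff] at hσ
  have key : ∀ m : ℕ,
      (∃ T, V T ∧ T.Nonempty ∧ ∀ σ ∈ (iterField K s m).fixingSubgroup, σ • T = T) →
      ∃ T, V T ∧ T.Nonempty ∧ ∀ σ ∈ (iterField K s 0).fixingSubgroup, σ • T = T := by
    intro m
    induction m with
    | zero => exact id
    | succ m ih =>
      intro hm
      rw [iterField_succ hs] at hm
      exact ih (exists_smul_eq_self_of_sup_adjoin_image hadd hsmul s _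
        (fun r hr ↦ sqrt_sq_mem_iterField hs hr) hm)
  obtain ⟨T, hT, hne, hfix⟩ := key n ⟨T₀, ⟨hT₀, hmem₀⟩, hne₀, fun σ hσ ↦ by
    rw [IntermediateField.mem_fixingSubgroup_iff] at hσ
    rw [Finset.smul_finset_def]
    convert Finset.image_id using 1
    exact Finset.image_congr fun r hr ↦ hσ r (mem_iterField (hT₀ hr))⟩
  rw [iterField_zero, fixingSubgroup_bot] at hfix
  rcases eq_empty_or_eq_iterRoots ht hT.1 fun σ ↦ hfix σ (Subgroup.mem_top σ) with rfl | rfl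
  · exact Finset.not_nonempty_empty hne
  · exact h hT.2

/-- An element of the `n`-th field whose square lies in `K` is, up to `K`, a product of the
elements `∏ r ∈ iterRoots s i, s r` with `i < n`. -/
theorem exists_mul_prod_mem_bot [IsGalois K Ω]
    (hs : ∀ r, s r ^ 2 = r - algebraMap K Ω c)
    (hP : ∀ n, (∏ r ∈ iterRoots s n, s r) ^ 2 ∈ (⊥ : IntermediateField K Ω))
    (hc : ∀ n, algebraMap K Ω c ∉ iterRoots s n) {n : ℕ}
    (hi : ∀ m < n, IndependentAt K s m) (ht : ∀ m < n, TransitiveAt K s m)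
    {y : Ω} (hy : y ∈ iterField K s n) (hy2 : y ^ 2 ∈ (⊥ : IntermediateField K Ω)) :
    ∃ S ⊆ Finset.range n,
      y * ∏ i ∈ S, ∏ r ∈ iterRoots s i, s r ∈ (⊥ : IntermediateField K Ω) := by
  induction n generalizing y with
  | zero => exact ⟨∅, by simp, by simpa [iterField_zero] using hy⟩
  | succ n ih =>
    have ih := @ih (fun m hm ↦ hi m (hm.trans n.lt_succ_self))
      (fun m hm ↦ ht m (hm.trans n.lt_succ_self))
    have hrange : Finset.range n ⊆ Finset.range (n + 1) :=
      Finset.range_subset_range.2 n.le_succ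
    rcases eq_or_ne y 0 with rfl | hy0
    · exact ⟨∅, by simp, by simp⟩
    have hy2' : y ^ 2 ∈ iterField K s n := (bot_le : ⊥ ≤ iterField K s n) hy2
    rw [iterField_succ hs] at hy
    obtain ⟨T, hT, hm⟩ := exists_mul_prod_mem_of_sq_mem s _
      (fun r hr ↦ sqrt_sq_mem_iterField hs hr) hy2' hy
    have hfix : ∀ σ : Gal(Ω/K), σ • T = T := by
      intro σ
      have hσy : σ y = y ∨ σ y = -y :=
        eq_or_eq_neg_of_sq_mem hy2 (by rw [fixingSubgroup_bot]; exact Subgroup.mem_top σ)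
      have hm' : y * ∏ r ∈ σ • T, s r ∈ iterField K s n := by
        have h := map_mem_iterField hs σ hm
        rw [map_mul] at h
        rcases hσy with h1 | h1 <;> rcases map_prod_sqrt hs σ T with h2 | h2 <;>
          rw [h1, h2] at h <;> simpa using h
      have hprod : (∏ r ∈ σ • T, s r) * ∏ r ∈ T, s r ∈ iterField K s n := by
        have h := div_mem (mul_mem hm' hm) hy2'
        convert h using 1
        field_simp
      have hmem := prod_sqrt_symmDiff_mem hs (hc n) (smul_subset_iterRoots hs σ hT) hprod
      by_contra hne
      refine hi n n.lt_succ_self _ ?_ ?_ hmem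
      · exact (Finset.symmDiff_subset_union).trans
          (Finset.union_subset (smul_subset_iterRoots hs σ hT) hT)
      · rwa [Finset.nonempty_iff_ne_empty, ← Finset.bot_eq_empty, Ne, symmDiff_eq_bot]
    rcases eq_empty_or_eq_iterRoots (ht n n.lt_succ_self) hT hfix with rfl | rfl
    · obtain ⟨S, hS, h⟩ := ih (by simpa using hm) hy2
      exact ⟨S, hS.trans hrange, h⟩
    · obtain ⟨S, hS, h⟩ := ih hm (by rw [mul_pow]; exact mul_mem hy2 (hP n))
      have hn : n ∉ S := fun h ↦ by simpa using hS h
      refine ⟨insert n S, ?_, ?_⟩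
      · exact Finset.insert_subset (Finset.self_mem_range_succ n) (hS.trans hrange)
      · rwa [Finset.prod_insert hn, ← mul_assoc]

theorem finrank_iterField_eq_iff [IsGalois K Ω] (hs : ∀ r, s r ^ 2 = r - algebraMap K Ω c)
    (hc : ∀ n, algebraMap K Ω c ∉ iterRoots s n) (hcard : ∀ n, (iterRoots s n).card = 2 ^ n) :
    (∀ n, 1 ≤ n → Module.finrank K (iterField K s n) = 2 ^ (2 ^ n - 1)) ↔
      ∀ n, IndependentAt K s n := by
  have hexp : ∀ n, 2 ^ (2 ^ (n + 1) - 1) = 2 ^ (2 ^ n - 1) * 2 ^ 2 ^ n := fun n ↦ by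
    rw [← pow_add]
    congr 1
    have := Nat.one_le_two_pow (n := n)
    rw [pow_succ]
    omega
  have hzero : Module.finrank K (iterField K s 0) = 2 ^ (2 ^ 0 - 1) := by
    rw [iterField_zero, IntermediateField.finrank_bot]
    rfl
  have hstep : ∀ n, Module.finrank K (iterField K s n) = 2 ^ (2 ^ n - 1) →
      (Module.finrank K (iterField K s (n + 1)) = 2 ^ (2 ^ (n + 1) - 1) ↔
        IndependentAt K s n) := fun n hn ↦ by
    have h := finrank_sup_adjoin_image_eq_iff (E := iterField K s n)
      (by rw [hn]; positivity) s (iterRoots s n) (fun r hr ↦ sqrt_sq_mem_iterField hs hr)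
      (fun r hr ↦ sqrt_ne_zero hs (hc n) hr)
    rwa [← iterField_succ hs, hn, hcard, ← hexp] at h
  constructor
  · intro h n
    refine (hstep n ?_).1 (h (n + 1) n.succ_pos)
    rcases n.eq_zero_or_pos with rfl | hn
    · exact hzero
    · exact h n hn
  · intro h n _
    induction n with
    | zero => exact hzero
    | succ n ih =>
      rcases n.eq_zero_or_pos with rfl | hn
      · exact (hstep 0 hzero).2 (h 0)
      · exact (hstep n (ih hn)).2 (h n)

end IteratedPreimages

section Polynomials

theorem polyIter_succ_eq_comp {K : Type*} [Field K] (f : K[X]) (n : ℕ) :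
    polyIter f (n + 1) = (polyIter f n).comp f := by
  induction n with
  | zero => simp [polyIter]
  | succ n ih =>
    exact (congrArg f.comp ih).trans (comp_assoc _ _ _).symm

theorem sqrt_injective {K Ω : Type*} [Field K] [Field Ω] [Algebra K Ω] {c : K} {s : Ω → Ω}
    (hs : ∀ r, s r ^ 2 = r - algebraMap K Ω c) : Function.Injective s := by
  intro a b hab
  have := hs a
  rwa [hab, hs, sub_left_inj, eq_comm] at this

theorem neg_sqrt_injective {K Ω : Type*} [Field K] [Field Ω] [Algebra K Ω] {c : K} {s : Ω → Ω}
    (hs : ∀ r, s r ^ 2 = r - algebraMap K Ω c) : Function.Injective fun r ↦ -s r :=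
  neg_injective.comp (sqrt_injective hs)

variable {K Ω : Type*} [Field K] [Field Ω] [Algebra K Ω] [DecidableEq Ω] {c : K} {s : Ω → Ω}

theorem aeval_polyIter_of_mem_iterRoots (hs : ∀ r, s r ^ 2 = r - algebraMap K Ω c) {n : ℕ} {x : Ω}
    (hx : x ∈ iterRoots s n) : aeval x (polyIter (X ^ 2 + C c) n) = 0 := by
  induction n generalizing x with
  | zero => simpa [iterRoots, polyIter] using hx
  | succ n ih =>
    rw [polyIter_succ_eq_comp, aeval_comp]
    simpa using ih ((mem_iterRoots_succ hs).1 hx)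

theorem algebraMap_notMem_iterRoots (hs : ∀ r, s r ^ 2 = r - algebraMap K Ω c) {n : ℕ}
    (h : (polyIter (X ^ 2 + C c) n).eval c ≠ 0) : algebraMap K Ω c ∉ iterRoots s n := fun hmem ↦ by
  have := aeval_polyIter_of_mem_iterRoots hs hmem
  rw [aeval_algebraMap_apply, coe_aeval_eq_eval, map_eq_zero] at this
  exact h this

theorem disjoint_image_sqrt (h2 : (2 : Ω) ≠ 0) (hs : ∀ r, s r ^ 2 = r - algebraMap K Ω c) {n : ℕ}
    (hc : algebraMap K Ω c ∉ iterRoots s n) :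
    Disjoint ((iterRoots s n).image s) ((iterRoots s n).image fun r ↦ -s r) := by
  rw [Finset.disjoint_left]
  simp only [Finset.mem_image]
  rintro _ ⟨r, hr, rfl⟩ ⟨r', -, h⟩
  have hrr : r' = r := by
    have := congrArg (· ^ 2) h
    simpa [hs] using this
  rw [hrr, neg_eq_iff_add_eq_zero, ← two_mul] at h
  exact (mul_ne_zero h2 (sqrt_ne_zero hs hc hr)) h

theorem card_iterRoots (h2 : (2 : Ω) ≠ 0) (hs : ∀ r, s r ^ 2 = r - algebraMap K Ω c)
    (hc : ∀ n, algebraMap K Ω c ∉ iterRoots s n) (n : ℕ) : (iterRoots s n).card = 2 ^ n := by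
  induction n with
  | zero => rfl
  | succ n ih =>
    rw [iterRoots, Finset.card_union_of_disjoint (disjoint_image_sqrt h2 hs (hc n)),
      Finset.card_image_of_injective _ (sqrt_injective hs),
      Finset.card_image_of_injective _ (neg_sqrt_injective hs), ih, pow_succ,
      mul_two]

theorem map_polyIter_eq_prod (h2 : (2 : Ω) ≠ 0) (hs : ∀ r, s r ^ 2 = r - algebraMap K Ω c)
    (hc : ∀ n, algebraMap K Ω c ∉ iterRoots s n) (n : ℕ) :
    (polyIter (X ^ 2 + C c) n).map (algebraMap K Ω) = ∏ r ∈ iterRoots s n, (X - C r) := by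
  induction n with
  | zero => simp [polyIter, iterRoots]
  | succ n ih =>
    rw [polyIter_succ_eq_comp, Polynomial.map_comp, ih, prod_comp, iterRoots,
      Finset.prod_union (disjoint_image_sqrt h2 hs (hc n)),
      Finset.prod_image (sqrt_injective hs).injOn,
      Finset.prod_image (neg_sqrt_injective hs).injOn, ← Finset.prod_mul_distrib]
    refine Finset.prod_congr rfl fun r _ ↦ ?_
    have h : (C (s r) : Polynomial Ω) ^ 2 = C r - C (algebraMap K Ω c) := by rw [← C_pow, hs, C_sub]
    simp only [sub_comp, X_comp, C_comp, Polynomial.map_add, Polynomial.map_pow, map_X, map_C,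
      C_neg]
    linear_combination h

theorem prod_sqrt_sq (h2 : (2 : Ω) ≠ 0) (hs : ∀ r, s r ^ 2 = r - algebraMap K Ω c)
    (hc : ∀ n, algebraMap K Ω c ∉ iterRoots s n) (n : ℕ) :
    (∏ r ∈ iterRoots s n, s r) ^ 2 =
      algebraMap K Ω ((-1) ^ 2 ^ n * (polyIter (X ^ 2 + C c) n).eval c) := by
  have h := congrArg (eval (algebraMap K Ω c)) (map_polyIter_eq_prod h2 hs hc n)
  rw [eval_map_algebraMap, aeval_algebraMap_apply, coe_aeval_eq_eval, eval_prod] at h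
  rw [map_mul, h, ← card_iterRoots h2 hs hc n, ← Finset.prod_pow, map_pow, map_neg, map_one,
    ← Finset.prod_const, ← Finset.prod_mul_distrib]
  refine Finset.prod_congr rfl fun r _ ↦ ?_
  rw [hs, eval_sub, eval_X, eval_C]
  ring

theorem finrank_splittingField_polyIter (h2 : (2 : Ω) ≠ 0)
    (hs : ∀ r, s r ^ 2 = r - algebraMap K Ω c)
    (hc : ∀ n, algebraMap K Ω c ∉ iterRoots s n) (n : ℕ) :
    Module.finrank K (SplittingField (polyIter (X ^ 2 + C c) n)) =
      Module.finrank K (iterField K s n) := by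
  have hmap := map_polyIter_eq_prod h2 hs hc n
  have hsplits : ((polyIter (X ^ 2 + C c) n).map (algebraMap K Ω)).Splits := by
    rw [hmap]
    exact Splits.prod fun r _ ↦ Splits.X_sub_C r
  have hroots : (polyIter (X ^ 2 + C c) n).rootSet Ω = iterRoots s n := by
    rw [rootSet, aroots, hmap, roots_prod_X_sub_C]
    simp
  have := adjoin_rootSet_isSplittingField hsplits
  rw [hroots, ← iterField] at this
  exact (IsSplittingField.algEquiv (iterField K s n)
    (polyIter (X ^ 2 + C c) n)).toLinearEquiv.finrank_eq.symm

end Polynomials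

theorem neg_one_pow_mul_eval_polyIter {K : Type*} [Field K] {c : K} {cseq : ℕ → K}
    (hc1 : cseq 1 = -c) (hcrec : ∀ n : ℕ, 1 ≤ n → cseq (n + 1) = (cseq n) ^ 2 + c) (n : ℕ) :
    (-1) ^ 2 ^ n * (polyIter (X ^ 2 + C c) n).eval c = cseq (n + 1) := by
  induction n with
  | zero => simp [polyIter, hc1]
  | succ n ih =>
    have heven : Even (2 ^ (n + 1)) := by simp [Nat.even_pow]
    rw [hcrec (n + 1) n.succ_pos, ← ih, heven.neg_one_pow, polyIter, mul_pow, ← pow_mul,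
      ← pow_succ, heven.neg_one_pow]
    simp

/-- **Stoll's criterion** in terms of the iterated preimages of `0` in a Galois extension `Ω`. -/
theorem forall_independentAt_iff {K Ω : Type*} [Field K] [Field Ω] [Algebra K Ω] [DecidableEq Ω]
    [IsGalois K Ω] {c : K} {s : Ω → Ω} (hs : ∀ r, s r ^ 2 = r - algebraMap K Ω c)
    (hc : ∀ n, algebraMap K Ω c ∉ iterRoots s n) {d : ℕ → K}
    (hd : ∀ n, (∏ r ∈ iterRoots s n, s r) ^ 2 = algebraMap K Ω (d n)) :
    (∀ n, IndependentAt K s n) ↔ ∀ S : Finset ℕ, S.Nonempty → ¬ ∃ y, y ^ 2 = ∏ n ∈ S, d n := by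
  have hne : ∀ n, ∏ r ∈ iterRoots s n, s r ≠ 0 := fun n ↦
    Finset.prod_ne_zero_iff.2 fun r hr ↦ sqrt_ne_zero hs (hc n) hr
  have hprod : ∀ S : Finset ℕ, (∏ n ∈ S, ∏ r ∈ iterRoots s n, s r) ^ 2 =
      algebraMap K Ω (∏ n ∈ S, d n) := fun S ↦ by
    rw [← Finset.prod_pow, map_prod]
    exact Finset.prod_congr rfl fun n _ ↦ hd n
  constructor
  · rintro hi S hS ⟨y, hy⟩
    set m := S.max' hS
    have hmS : m ∈ S := S.max'_mem hS
    have htot : ∏ n ∈ S, ∏ r ∈ iterRoots s n, s r ∈ iterField K s m := by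
      have h := hprod S
      rw [← hy, map_pow] at h
      rcases sq_eq_sq_iff_eq_or_eq_neg.1 h with h | h <;> rw [h]
      · exact IntermediateField.algebraMap_mem _ y
      · exact neg_mem (IntermediateField.algebraMap_mem _ y)
    have hrest : ∏ n ∈ S.erase m, ∏ r ∈ iterRoots s n, s r ∈ iterField K s m :=
      prod_mem fun n hn ↦ iterField_mono hs (Nat.succ_le_of_lt (S.lt_max'_of_mem_erase_max' hS hn))
        (prod_sqrt_mem_iterField_succ subset_rfl)
    refine hi m _ subset_rfl (iterRoots_nonempty s m) ?_
    rw [← mul_div_cancel_right₀ (∏ r ∈ iterRoots s m, s r)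
        (Finset.prod_ne_zero_iff.2 fun n (_ : n ∈ S.erase m) ↦ hne n),
      Finset.mul_prod_erase S (fun n ↦ ∏ r ∈ iterRoots s n, s r) hmS]
    exact div_mem htot hrest
  · intro hS
    suffices h : ∀ n, IndependentAt K s n ∧ TransitiveAt K s n from fun n ↦ (h n).1
    intro n
    induction n using Nat.strong_induction_on with
    | _ n ih =>
      have ht : TransitiveAt K s n := by
        rcases n with _ | n
        · intro r hr r' hr'
          rw [iterRoots, Finset.mem_singleton] at hr hr'
          exact ⟨1, by simp [hr, hr']⟩
        · exact (ih n n.lt_succ_self).2.succ hs (ih n n.lt_succ_self).1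
      refine ⟨independentAt_of_prod_notMem hs (hc n) ht fun hmem ↦ ?_, ht⟩
      have hP : ∀ n, (∏ r ∈ iterRoots s n, s r) ^ 2 ∈ (⊥ : IntermediateField K Ω) := fun n ↦ by
        rw [hd]
        exact IntermediateField.algebraMap_mem _ _
      obtain ⟨S, hSn, h⟩ := exists_mul_prod_mem_bot hs hP hc (fun m hm ↦ (ih m hm).1)
        (fun m hm ↦ (ih m hm).2) hmem (hP n)
      have hnS : n ∉ S := fun h ↦ by simpa using hSn h
      rw [← Finset.prod_insert (f := fun m ↦ ∏ r ∈ iterRoots s m, s r) hnS,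
        IntermediateField.mem_bot] at h
      obtain ⟨y, hy⟩ := h
      refine hS (insert n S) (Finset.insert_nonempty n S) ⟨y, (algebraMap K Ω).injective ?_⟩
      rw [map_pow, hy, hprod]

end StollCriterion

/-- **Stoll's criterion.** Let `K` be a field of characteristic `≠ 2`, let
`c ∈ K` and `f = x² + c`.  Define the adjusted post-critical orbit by `c₁ = −c`,
`c_{n+1} = f(c_n)`, and assume `c_n ≠ 0` for all `n ≥ 1`.  Then the splitting field
`K_n(f)` of `f^n` over `K` satisfies `[K_n(f) : K] = 2^(2^n − 1)` for every `n ≥ 1`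
if and only if for every nonempty finite set `S ⊆ ℤ_{≥1}` the product `∏_{n∈S} c_n` is
not a square in `K` (i.e. the classes of the `c_n` are `𝔽₂`-linearly independent in
`K^×/(K^×)²`). -/
theorem stmt0 (K : Type*) [Field K] (hchar : ringChar K ≠ 2) (c : K)
    (cseq : ℕ → K) (hc1 : cseq 1 = -c)
    (hcrec : ∀ n : ℕ, 1 ≤ n → cseq (n + 1) = (cseq n) ^ 2 + c)
    (hcne : ∀ n : ℕ, 1 ≤ n → cseq n ≠ 0) :
    (∀ n : ℕ, 1 ≤ n →
        Module.finrank K (SplittingField (polyIter (X ^ 2 + C c) n)) = 2 ^ (2 ^ n - 1)) ↔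
      ∀ S : Finset ℕ, S.Nonempty → (∀ n ∈ S, 1 ≤ n) →
        ¬ ∃ y : K, y ^ 2 = ∏ n ∈ S, cseq n := by
  classical
  have h2 : (2 : K) ≠ 0 := Ring.two_ne_zero hchar
  have hΩ2 : (2 : SeparableClosure K) ≠ 0 := by
    rw [← map_ofNat (algebraMap K (SeparableClosure K)) 2]
    exact (_root_.map_ne_zero (algebraMap K (SeparableClosure K))).2 h2
  have : NeZero (2 : SeparableClosure K) := ⟨hΩ2⟩
  have hsqrt : ∀ r : SeparableClosure K, ∃ z, z ^ 2 = r - algebraMap K (SeparableClosure K) c :=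
    fun r ↦ by
      obtain ⟨z, hz⟩ := IsSepClosed.exists_eq_mul_self (r - algebraMap K (SeparableClosure K) c)
      exact ⟨z, by rw [hz, sq]⟩
  choose s hs using hsqrt
  have hval := neg_one_pow_mul_eval_polyIter hc1 hcrec
  have hc : ∀ n, algebraMap K (SeparableClosure K) c ∉ iterRoots s n := fun n ↦
    algebraMap_notMem_iterRoots hs fun h ↦ hcne (n + 1) n.succ_pos (by rw [← hval, h, mul_zero])
  have hd : ∀ n, (∏ r ∈ iterRoots s n, s r) ^ 2 =
      algebraMap K (SeparableClosure K) (cseq (n + 1)) := fun n ↦ by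
    rw [prod_sqrt_sq hΩ2 hs hc, hval]
  simp only [finrank_splittingField_polyIter hΩ2 hs hc]
  rw [finrank_iterField_eq_iff hs hc (card_iterRoots hΩ2 hs hc), forall_independentAt_iff hs hc hd]
  constructor
  · intro h S hS hpos
    have hsub : (S.image Nat.pred).image Nat.succ = S := by
      rw [Finset.image_image]
      convert Finset.image_id using 1
      exact Finset.image_congr fun n hn ↦ Nat.succ_pred_eq_of_pos (hpos n hn)
    rw [← hsub, Finset.prod_image Nat.succ_injective.injOn]
    exact h _ (hS.image _)
  · intro h S hS
    have := h (S.image Nat.succ) (hS.image _) (by simp)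
    rwa [Finset.prod_image Nat.succ_injective.injOn] at this
end

section
/- Fix a prime p and q = p^r. Let K be an 𝔽_q-field, let t₀, s₀ ∈ K with t₀ ≠ 0, and let f = x^q + t₀x + s₀ ∈ K[x]. If there exists θ₀ ∈ K with θ₀^(q−1) = −t₀, then for every n ≥ 1 the degree [K_n(f) : K] is a power of p dividing q^(2n−1) (equivalently, the image of the canonical embedding of the dynamical Galois group of f into Φ_∞ ≅ 𝔽_q[[y]] ⋊ 𝔽_q[[y]]^× is contained in the pro-p subgroup Φ_{∞,1} ≅ 𝔽_q[[y]] ⋊ (1 + y𝔽_q[[y]]) of index q − 1). -/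
open Polynomial

/-- The additive endomorphism `x ↦ x ^ (p ^ r) + t * x` of a ring of characteristic exponent `p`. -/
noncomputable def frobAddMul {R : Type*} [CommRing R] (p r : ℕ) [ExpChar R p] (t : R) :
    AddMonoid.End R :=
  (iterateFrobenius R p r : R →+ R) + AddMonoidHom.mulLeft t

section frobAddMul

variable {R : Type*} [CommRing R] {p r : ℕ} [ExpChar R p]

theorem frobAddMul_apply (t x : R) : frobAddMul p r t x = x ^ p ^ r + t * x := rfl

theorem frobAddMul_pow_succ_apply (t x : R) (n : ℕ) :
    (frobAddMul p r t ^ (n + 1)) x = frobAddMul p r t ((frobAddMul p r t ^ n) x) := by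
  rw [pow_succ']
  rfl

theorem frobAddMul_pow_add_apply (t x : R) (m n : ℕ) :
    (frobAddMul p r t ^ (m + n)) x = (frobAddMul p r t ^ m) ((frobAddMul p r t ^ n) x) := by
  rw [pow_add]
  rfl

theorem frobAddMul_pow_mul {t c : R} (hc : c ^ p ^ r = c) (x : R) (n : ℕ) :
    (frobAddMul p r t ^ n) (c * x) = c * (frobAddMul p r t ^ n) x := by
  induction n with
  | zero => simp
  | succ n ih =>
    rw [frobAddMul_pow_succ_apply, ih, frobAddMul_pow_succ_apply, frobAddMul_apply,
      frobAddMul_apply, mul_pow, hc]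
    ring

theorem map_frobAddMul_pow {G : Type*} [FunLike G R R] [RingHomClass G R R] (σ : G) {t : R}
    (ht : σ t = t) (x : R) (n : ℕ) :
    σ ((frobAddMul p r t ^ n) x) = (frobAddMul p r t ^ n) (σ x) := by
  induction n with
  | zero => simp
  | succ n ih =>
    simp only [frobAddMul_pow_succ_apply, frobAddMul_apply, map_add, map_mul, map_pow, ih, ht]

end frobAddMul

section polyIter

variable {K : Type*} [Field K] {p r : ℕ} (t s : K)

theorem natDegree_polyIter (f : K[X]) (n : ℕ) : (polyIter f n).natDegree = f.natDegree ^ n := by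
  induction n with
  | zero => simp [polyIter]
  | succ n ih => rw [polyIter, natDegree_comp, ih, pow_succ']

theorem natDegree_X_pow_add_C_mul_X_add_C {q : ℕ} (hq : 1 < q) :
    (X ^ q + C t * X + C s).natDegree = q := by
  compute_degree!
  all_goals grind

theorem separable_polyIter {f : K[X]} {u : K} (hu : u ≠ 0) (hf : derivative f = C u) (n : ℕ) :
    (polyIter f n).Separable := by
  have h : derivative (polyIter f n) = C (u ^ n) := by
    induction n with
    | zero => simp [polyIter]
    | succ n ih => simp [polyIter, derivative_comp, ih, hf, pow_succ]
  rw [Polynomial.Separable, h]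
  exact isCoprime_one_right.of_isCoprime_of_dvd_right
    (isUnit_C.2 (pow_ne_zero n hu).isUnit).dvd

theorem aeval_polyIter_add {R : Type*} [CommRing R] [Algebra K R] [ExpChar R p] (x y : R) (n : ℕ) :
    aeval (x + y) (polyIter (X ^ p ^ r + C t * X + C s) n) =
      aeval x (polyIter (X ^ p ^ r + C t * X + C s) n) +
        (frobAddMul p r (algebraMap K R t) ^ n) y := by
  induction n with
  | zero => simp [polyIter]
  | succ n ih =>
    rw [polyIter, aeval_comp, aeval_comp, ih, frobAddMul_pow_succ_apply, frobAddMul_apply]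
    simp only [map_add, map_mul, map_pow, aeval_X, aeval_C, add_pow_expChar_pow]
    ring

end polyIter

theorem GaloisField.mem_range_algebraMap_of_pow_eq {p r : ℕ} [Fact p.Prime] (hr : r ≠ 0)
    {L : Type*} [Field L] [Algebra (GaloisField p r) L] {c : L} (hc : c ^ p ^ r = c) :
    c ∈ (algebraMap (GaloisField p r) L).range := by
  classical
  have := Fintype.ofFinite (GaloisField p r)
  have hcard : Fintype.card (GaloisField p r) = p ^ r := by
    rw [← Nat.card_eq_fintype_card, GaloisField.card p r hr]
  have hs := IsSplittingField.splits (GaloisField p r)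
    (X ^ Fintype.card (GaloisField p r) - X : (GaloisField p r)[X])
  rw [Algebra.algebraMap_self, Polynomial.map_id] at hs
  have h0 := FiniteField.X_pow_card_sub_X_ne_zero (GaloisField p r)
    (Fintype.one_lt_card (α := GaloisField p r))
  exact hs.mem_range_of_isRoot h0 (by simp [hcard, hc])

section Galois

variable {K L : Type*} [Field K] [Field L] [Algebra K L] {p r : ℕ} [Fact p.Prime]
  [ExpChar L p] {t θ : K}

variable (L) in
theorem card_ker_frobAddMul_pow_le (hr : r ≠ 0) (t : K) (n : ℕ) :
    Finite (frobAddMul p r (algebraMap K L t) ^ n).ker ∧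
      Nat.card (frobAddMul p r (algebraMap K L t) ^ n).ker ≤ (p ^ r) ^ n := by
  have hq : 1 < p ^ r := Nat.one_lt_pow hr (Fact.out : p.Prime).one_lt
  let P := polyIter (X ^ p ^ r + C t * X + C 0) n
  have hdeg : P.natDegree = (p ^ r) ^ n := by
    rw [natDegree_polyIter, natDegree_X_pow_add_C_mul_X_add_C t 0 hq]
  have hP0 : P ≠ 0 := ne_zero_of_natDegree_gt (n := 0) (by rw [hdeg]; positivity)
  have hz (i : ℕ) : aeval (0 : L) (polyIter (X ^ p ^ r + C t * X + C 0) i) = 0 := by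
    induction i with
    | zero => simp [polyIter]
    | succ i ih => rw [polyIter, aeval_comp, ih]; simp [(Fact.out : p.Prime).ne_zero]
  have hsub : ((frobAddMul p r (algebraMap K L t) ^ n).ker : Set L) ⊆ P.rootSet L := by
    intro x hx
    have hx0 : (frobAddMul p r (algebraMap K L t) ^ n) x = 0 := hx
    have h := aeval_polyIter_add (p := p) (r := r) t 0 0 x n
    rw [hz, zero_add, hx0, zero_add] at h
    exact (mem_rootSet_of_ne hP0).2 h
  refine ⟨(P.rootSet_finite L).subset hsub, ?_⟩
  exact (Set.ncard_le_ncard hsub (P.rootSet_finite L)).trans ((ncard_rootSet_le P L).trans hdeg.le)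

theorem exists_frobAddMul_pow_eq_of_splits (hr : r ≠ 0) (hθt : θ ^ p ^ r + t * θ = 0)
    {s : K} {n : ℕ}
    (hsplit : ((polyIter (X ^ p ^ r + C t * X + C s) (n + 1)).map (algebraMap K L)).Splits) {β : L}
    (hβ : aeval β (polyIter (X ^ p ^ r + C t * X + C s) (n + 1)) = 0) :
    ∃ w : L, (frobAddMul p r (algebraMap K L t) ^ n) w = algebraMap K L θ := by
  have hdeg (i : ℕ) : (polyIter (X ^ p ^ r + C t * X + C s) i).natDegree = (p ^ r) ^ i := by
    rw [natDegree_polyIter, natDegree_X_pow_add_C_mul_X_add_C t s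
      (Nat.one_lt_pow hr (Fact.out : p.Prime).one_lt)]
  have hp := (Fact.out : p.Prime).pos
  have hP0 : (polyIter (X ^ p ^ r + C t * X + C s) (n + 1)).map (algebraMap K L) ≠ 0 :=
    (Polynomial.map_ne_zero_iff (algebraMap K L).injective).2
      (ne_zero_of_natDegree_gt (n := 0) (by rw [hdeg]; positivity))
  rw [polyIter] at hβ hsplit hP0
  set Q := polyIter (X ^ p ^ r + C t * X + C s) n with hQ
  set γ := aeval β Q + algebraMap K L θ with hγ
  have hroot : ((X ^ p ^ r + C t * X + C s : K[X]).map (algebraMap K L)).IsRoot γ := by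
    have hθL := congrArg (algebraMap K L) hθt
    rw [aeval_comp] at hβ
    simp only [map_add, map_mul, map_pow, map_zero, aeval_X, aeval_C] at hβ hθL
    simp only [IsRoot.def, eval_map_algebraMap, map_add, map_mul, map_pow, aeval_X, aeval_C, hγ,
      add_pow_expChar_pow]
    linear_combination hβ + hθL
  have hdvd : Q.map (algebraMap K L) - C γ ∣
      ((X ^ p ^ r + C t * X + C s).comp Q).map (algebraMap K L) := by
    obtain ⟨g, hg⟩ := dvd_iff_isRoot.2 hroot
    rw [map_comp, hg, mul_comp, sub_comp, X_comp, C_comp]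
    exact dvd_mul_right _ _
  obtain ⟨β', hβ'⟩ := (hsplit.of_dvd hP0 hdvd).exists_eval_eq_zero
    (degree_ne_of_natDegree_ne (by rw [natDegree_sub_C, natDegree_map, hQ, hdeg]; positivity))
  rw [eval_sub, eval_C, eval_map_algebraMap, sub_eq_zero] at hβ'
  refine ⟨β' - β, ?_⟩
  have h := aeval_polyIter_add (p := p) (r := r) t s β (β' - β) n
  rw [← hQ, add_sub_cancel, hβ', hγ] at h
  exact (add_left_cancel h).symm

variable [Algebra (GaloisField p r) K]

theorem exists_mul_of_frobAddMul_eq_zero (hr : r ≠ 0) (hθ : θ ≠ 0)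
    (hθt : θ ^ p ^ r + t * θ = 0) {x : L}
    (hx : frobAddMul p r (algebraMap K L t) x = 0) :
    ∃ c : K, c ^ p ^ r = c ∧ x = algebraMap K L (c * θ) := by
  let _ : Algebra (GaloisField p r) L := ((algebraMap K L).comp (algebraMap _ K)).toAlgebra
  have hθ' : algebraMap K L θ ≠ 0 := by simpa
  have hc : (x / algebraMap K L θ) ^ p ^ r = x / algebraMap K L θ := by
    have h1 : x ^ p ^ r = -(algebraMap K L t * x) := eq_neg_of_add_eq_zero_left hx
    have h2 : algebraMap K L θ ^ p ^ r = -(algebraMap K L t * algebraMap K L θ) := by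
      rw [← map_pow, eq_neg_of_add_eq_zero_left hθt, map_neg, map_mul]
    have h3 : algebraMap K L θ ^ p ^ r ≠ 0 := pow_ne_zero _ hθ'
    rw [div_pow, div_eq_div_iff h3 hθ', h1, h2]
    ring
  obtain ⟨c, hc'⟩ := GaloisField.mem_range_algebraMap_of_pow_eq hr hc
  refine ⟨algebraMap _ K c, ?_, ?_⟩
  · apply (algebraMap K L).injective
    rw [map_pow]
    change (algebraMap (GaloisField p r) L c) ^ p ^ r = algebraMap (GaloisField p r) L c
    rw [hc', hc]
  · rw [map_mul]
    change x = algebraMap (GaloisField p r) L c * _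
    rw [hc', div_mul_cancel₀ _ hθ']

theorem sub_one_pow_apply_eq_zero (hr : r ≠ 0) (hθ : θ ≠ 0) (hθt : θ ^ p ^ r + t * θ = 0)
    (σ : L ≃ₐ[K] L) (n : ℕ) {x : L} (hx : (frobAddMul p r (algebraMap K L t) ^ n) x = 0) :
    ((σ.toLinearMap - 1 : Module.End K L) ^ n) x = 0 := by
  induction n generalizing x with
  | zero => simpa using hx
  | succ n ih =>
    rw [pow_succ, Module.End.mul_apply]
    apply ih
    rw [frobAddMul_pow_succ_apply] at hx
    obtain ⟨c, -, hc⟩ := exists_mul_of_frobAddMul_eq_zero hr hθ hθt hx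
    rw [LinearMap.sub_apply, map_sub, AlgEquiv.toLinearMap_apply, Module.End.one_apply,
      ← map_frobAddMul_pow σ (σ.commutes t), hc, σ.commutes, sub_self]

theorem fixed_of_frobAddMul_pow_eq_zero (hr : r ≠ 0) (hθ : θ ≠ 0)
    (hθt : θ ^ p ^ r + t * θ = 0) (σ : L ≃ₐ[K] L) {n : ℕ} {w : L}
    (hw : (frobAddMul p r (algebraMap K L t) ^ n) w = algebraMap K L θ) (hσ : σ w = w)
    {i : ℕ} (hi : i ≤ n + 1) {x : L} (hx : (frobAddMul p r (algebraMap K L t) ^ i) x = 0) :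
    σ x = x := by
  induction i generalizing x with
  | zero => simp_all
  | succ i ih =>
    rw [frobAddMul_pow_succ_apply] at hx
    obtain ⟨c, hcq, hc⟩ := exists_mul_of_frobAddMul_eq_zero hr hθ hθt hx
    set y := algebraMap K L c * (frobAddMul p r (algebraMap K L t) ^ (n - i)) w with hy
    have hσy : σ y = y := by
      rw [hy, map_mul, σ.commutes, map_frobAddMul_pow σ (σ.commutes t), hσ]
    have h := ih (by omega) (x := x - y) (by
      rw [map_sub, hc, hy, frobAddMul_pow_mul (by rw [← map_pow, hcq]),
        ← frobAddMul_pow_add_apply, show i + (n - i) = n by omega, hw, map_mul, sub_self])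
    rwa [map_sub, hσy, sub_left_inj] at h

end Galois

section SplittingField

variable {K : Type*} [Field K] {p r : ℕ} [Fact p.Prime] [Algebra (GaloisField p r) K]
  {t s θ : K}

theorem isPGroup_gal_polyIter [CharP K p] (hr : r ≠ 0) (hθ : θ ≠ 0)
    (hθt : θ ^ p ^ r + t * θ = 0) (n : ℕ) :
    IsPGroup p (polyIter (X ^ p ^ r + C t * X + C s) n).Gal := by
  let P := polyIter (X ^ p ^ r + C t * X + C s) n
  change IsPGroup p P.Gal
  intro σ
  have : CharP P.SplittingField p := charP_of_injective_algebraMap' K p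
  have : ExpChar P.SplittingField p := ExpChar.prime Fact.out
  have : ExpChar (Module.End K P.SplittingField) p :=
    have : CharP (Module.End K P.SplittingField) p := charP_of_injective_algebraMap' K p
    ExpChar.prime Fact.out
  let τ : P.SplittingField ≃ₐ[K] P.SplittingField := σ
  refine ⟨n + 1, Gal.ext P fun x hx => ?_⟩
  have hx0 := (mem_rootSet.1 hx).2
  have hτx : aeval (τ x) P = 0 := by rw [aeval_algHom_apply, hx0, map_zero]
  have hker : (frobAddMul p r (algebraMap K P.SplittingField t) ^ n) (τ x - x) = 0 := by
    have h := aeval_polyIter_add (p := p) (r := r) t s x (τ x - x) n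
    change aeval _ P = aeval _ P + _ at h
    rwa [add_sub_cancel, hτx, hx0, zero_add, eq_comm] at h
  have hnil : ((τ.toLinearMap - 1 : Module.End K P.SplittingField) ^ (n + 1)) x = 0 := by
    rw [pow_succ, Module.End.mul_apply]
    exact sub_one_pow_apply_eq_zero hr hθ hθt τ n hker
  have hle : n + 1 ≤ p ^ (n + 1) := (Nat.lt_pow_self (Fact.out : p.Prime).one_lt).le
  have hzero : ((τ.toLinearMap - 1 : Module.End K P.SplittingField) ^ p ^ (n + 1)) x = 0 := by
    rw [← Nat.sub_add_cancel hle, pow_add, Module.End.mul_apply, hnil, map_zero]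
  rw [sub_pow_expChar_pow_of_commute _ _ (Commute.one_right _), one_pow, LinearMap.sub_apply,
    sub_eq_zero] at hzero
  have hpow : ∀ k : ℕ, (τ.toLinearMap ^ k : Module.End K P.SplittingField) x = (σ ^ k) x := by
    intro k
    induction k with
    | zero => rfl
    | succ k ih =>
      rw [pow_succ', pow_succ', Module.End.mul_apply, ih]
      rfl
  rw [← hpow, hzero]
  rfl

theorem card_gal_polyIter_le [CharP K p] (hr : r ≠ 0) (hθ : θ ≠ 0)
    (hθt : θ ^ p ^ r + t * θ = 0) (n : ℕ) :
    Nat.card (polyIter (X ^ p ^ r + C t * X + C s) (n + 1)).Gal ≤ (p ^ r) ^ (2 * n + 1) := by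
  have hq : 1 < p ^ r := Nat.one_lt_pow hr (Fact.out : p.Prime).one_lt
  let P := polyIter (X ^ p ^ r + C t * X + C s) (n + 1)
  let L := P.SplittingField
  have : CharP L p := charP_of_injective_algebraMap' K p
  have : ExpChar L p := ExpChar.prime Fact.out
  have hsplit : (P.map (algebraMap K L)).Splits := SplittingField.splits P
  have hP0 : P.degree ≠ 0 := by
    apply degree_ne_of_natDegree_ne
    rw [natDegree_polyIter, natDegree_X_pow_add_C_mul_X_add_C t s hq]
    positivity
  obtain ⟨β, hβ⟩ := hsplit.exists_eval_eq_zero (by rwa [degree_map])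
  rw [eval_map_algebraMap] at hβ
  have hsub {x : L} (hx : aeval x P = 0) :
      (frobAddMul p r (algebraMap K L t) ^ (n + 1)) (x - β) = 0 := by
    have h := aeval_polyIter_add (p := p) (r := r) t s β (x - β) (n + 1)
    change aeval _ P = aeval _ P + _ at h
    rwa [add_sub_cancel, hx, hβ, zero_add, eq_comm] at h
  obtain ⟨w, hw⟩ := exists_frobAddMul_pow_eq_of_splits hr hθt hsplit hβ
  set F := frobAddMul p r (algebraMap K L t) with hF
  have hroot (σ : L ≃ₐ[K] L) : (F ^ (n + 1)) (σ β - β) = 0 :=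
    hsub (by rw [aeval_algHom_apply, hβ, map_zero])
  have hroot' (σ : L ≃ₐ[K] L) : (F ^ n) (σ w - w) = 0 := by
    rw [map_sub, hF, ← map_frobAddMul_pow σ (σ.commutes t), ← hF, hw, σ.commutes, sub_self]
  obtain ⟨hfin₁, hcard₁⟩ := card_ker_frobAddMul_pow_le (p := p) L hr t (n + 1)
  obtain ⟨hfin₂, hcard₂⟩ := card_ker_frobAddMul_pow_le (p := p) L hr t n
  let φ : (L ≃ₐ[K] L) → (F ^ (n + 1)).ker × (F ^ n).ker :=
    fun σ => (⟨σ β - β, hroot σ⟩, ⟨σ w - w, hroot' σ⟩)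
  have hφ : Function.Injective φ := by
    intro σ τ h
    have h₁ : σ β = τ β := sub_left_injective (congrArg (fun y => (y.1 : L)) h)
    have h₂ : σ w = τ w := sub_left_injective (congrArg (fun y => (y.2 : L)) h)
    refine Gal.ext (p := P) fun x hx => ?_
    change σ x = τ x
    have hfix := fixed_of_frobAddMul_pow_eq_zero hr hθ hθt (σ.trans τ.symm) hw
      (by simp [h₂]) le_rfl (hsub (mem_rootSet.1 hx).2)
    rw [AlgEquiv.trans_apply, AlgEquiv.symm_apply_eq, map_sub, map_sub, h₁, sub_left_inj] at hfix
    exact hfix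
  calc Nat.card P.Gal ≤ Nat.card ((F ^ (n + 1)).ker × (F ^ n).ker) :=
        Nat.card_le_card_of_injective φ hφ
    _ ≤ (p ^ r) ^ (n + 1) * (p ^ r) ^ n := by
        rw [Nat.card_prod]
        exact Nat.mul_le_mul hcard₁ hcard₂
    _ = (p ^ r) ^ (2 * n + 1) := by ring

end SplittingField

/-- Let `q = p^r`, `K` an `𝔽_q`-field, `t₀, s₀ ∈ K` with `t₀ ≠ 0`, and
`f = x^q + t₀x + s₀`. If there is `θ₀ ∈ K` with `θ₀^(q−1) = −t₀`, then for every `n ≥ 1`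
the degree `[K_n(f) : K]` is a power of `p` dividing `q^(2n−1)` (i.e. the image of the
dynamical Galois group in `Φ_∞` lies in the pro-`p` subgroup `Φ_{∞,1}` of index `q−1`). -/
theorem stmt2 (p r : ℕ) [Fact p.Prime] (hr : 1 ≤ r) (q : ℕ) (hq : q = p ^ r)
    (K : Type*) [Field K] [Algebra (GaloisField p r) K]
    (t₀ s₀ : K) (ht₀ : t₀ ≠ 0) (θ₀ : K) (hθ₀ : θ₀ ^ (q - 1) = -t₀) :
    ∀ n : ℕ, 1 ≤ n →
      ∃ m : ℕ,
        Module.finrank K (SplittingField (polyIter (X ^ q + C t₀ * X + C s₀) n)) = p ^ m ∧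
          p ^ m ∣ q ^ (2 * n - 1) := by
  subst hq
  have hr0 : r ≠ 0 := by omega
  have hq : 1 < p ^ r := Nat.one_lt_pow hr0 (Fact.out : p.Prime).one_lt
  have : CharP K p := charP_of_injective_algebraMap' (GaloisField p r) p
  have hθ : θ₀ ≠ 0 := by
    rintro rfl
    rw [zero_pow (by omega)] at hθ₀
    exact ht₀ (neg_eq_zero.1 hθ₀.symm)
  have hθt : θ₀ ^ p ^ r + t₀ * θ₀ = 0 := by
    rw [← Nat.sub_add_cancel hq.le, pow_succ, hθ₀]
    ring
  have hderiv : derivative (X ^ p ^ r + C t₀ * X + C s₀ : K[X]) = C t₀ := by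
    simp [derivative_X_pow, hr0]
  intro n hn
  obtain ⟨n, rfl⟩ := Nat.exists_eq_add_of_le' hn
  obtain ⟨m, hm⟩ := IsPGroup.iff_card.1
    (isPGroup_gal_polyIter (s := s₀) hr0 hθ hθt (n + 1))
  refine ⟨m, ?_, ?_⟩
  · rw [← hm, Gal.card_of_separable (separable_polyIter ht₀ hderiv (n + 1))]
  · have hle := card_gal_polyIter_le (s := s₀) hr0 hθ hθt n
    rw [hm, ← pow_mul] at hle
    rw [← pow_mul, show 2 * (n + 1) - 1 = 2 * n + 1 by omega]
    exact pow_dvd_pow p ((Nat.pow_le_pow_iff_right (Fact.out : p.Prime).one_lt).1 hle)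
end

section
/- Let K = 𝔽_2(t) be the rational function field over 𝔽_2 and let f = x² + tx + t³ ∈ K[x]. Then for every n ≥ 1 the splitting field K_n(f) of the n-fold composition f^n over K satisfies [K_n(f) : K] = 2^(2n−1); that is, the dynamical Galois group of f is the full group Φ_∞ ≅ 𝔽_2[[y]] ⋊ 𝔽_2[[y]]^×. -/
open Polynomial

/-- The `n`-fold composition of `X ^ 2 + C s * X` with itself. Over a ring of characteristic `2` it
is the action of `t ^ n` under the Carlitz module of `𝔽₂[t]` with `t` mapped to `s`. -/
noncomputable def carlitzIter {R : Type*} [CommRing R] (s : R) : ℕ → R[X]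
  | 0 => X
  | n + 1 => carlitzIter s n ^ 2 + C s * carlitzIter s n

section Eisenstein

variable {R S : Type*} [CommRing R] [CommRing S]

theorem carlitzIter_map (φ : R →+* S) (s : R) (n : ℕ) :
    (carlitzIter s n).map φ = carlitzIter (φ s) n := by
  induction n with
  | zero => simp [carlitzIter]
  | succ n ih => simp [carlitzIter, ih]

theorem carlitzIter_zero_left (n : ℕ) : carlitzIter (0 : R) n = X ^ 2 ^ n := by
  induction n with
  | zero => simp [carlitzIter]
  | succ n ih => rw [carlitzIter, ih, C_0, zero_mul, add_zero, ← pow_mul, ← pow_succ]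

theorem carlitzIter_natDegree_monic [Nontrivial R] (s : R) (n : ℕ) :
    (carlitzIter s n).natDegree = 2 ^ n ∧ (carlitzIter s n).Monic := by
  induction n with
  | zero => simp [carlitzIter, monic_X]
  | succ n ih =>
    have hsq : (carlitzIter s n ^ 2).natDegree = 2 ^ (n + 1) := by
      rw [ih.2.natDegree_pow, ih.1, pow_succ']
    have hlt : (C s * carlitzIter s n).natDegree < (carlitzIter s n ^ 2).natDegree := by
      refine (natDegree_C_mul_le _ _).trans_lt ?_
      rw [hsq, ih.1]
      exact Nat.pow_lt_pow_right one_lt_two n.lt_succ_self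
    exact ⟨(natDegree_add_eq_left_of_natDegree_lt hlt).trans hsq,
      (ih.2.pow 2).add_of_left (degree_lt_degree hlt)⟩

theorem carlitzIter_add_C_natDegree [Nontrivial R] (s : R) (n : ℕ) :
    (carlitzIter s n + C s).natDegree = 2 ^ n := by
  rw [natDegree_add_C, (carlitzIter_natDegree_monic s n).1]

theorem carlitzIter_add_C_monic [Nontrivial R] (s : R) (n : ℕ) :
    (carlitzIter s n + C s).Monic := by
  refine (carlitzIter_natDegree_monic s n).2.add_of_left ?_
  refine degree_C_le.trans_lt (natDegree_pos_iff_degree_pos.mp ?_)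
  rw [(carlitzIter_natDegree_monic s n).1]
  positivity

theorem carlitzIter_coeff_zero (s : R) (n : ℕ) : (carlitzIter s n).coeff 0 = 0 := by
  induction n with
  | zero => simp [carlitzIter]
  | succ n ih => simp [carlitzIter, pow_two, mul_coeff_zero, ih]

theorem carlitzIter_add_C_isEisensteinAt {P : Ideal R} (hP : P.IsPrime) {s : R} (hs : s ∈ P)
    (hs2 : s ∉ P ^ 2) (n : ℕ) : (carlitzIter s n + C s).IsEisensteinAt P := by
  have : Nontrivial R := nontrivial_of_ne s 0 (by rintro rfl; exact hs2 (zero_mem _))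
  refine ⟨?_, fun {k} hk => ?_, ?_⟩
  · rw [(carlitzIter_add_C_monic s n).leadingCoeff]
    exact fun h => hP.ne_top ((Ideal.eq_top_iff_one P).2 h)
  · rw [carlitzIter_add_C_natDegree] at hk
    have hmap : (carlitzIter s n + C s).map (Ideal.Quotient.mk P) = X ^ 2 ^ n := by
      simp [carlitzIter_map, Ideal.Quotient.eq_zero_iff_mem.2 hs, carlitzIter_zero_left]
    rw [← Ideal.Quotient.eq_zero_iff_mem, ← coeff_map, hmap, coeff_X_pow, if_neg hk.ne]
  · simpa [carlitzIter_coeff_zero] using hs2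

theorem carlitzIter_add_C_irreducible [IsDomain R] [IsIntegrallyClosed R] {F : Type*} [Field F]
    [Algebra R F] [IsFractionRing R F] {P : Ideal R} (hP : P.IsPrime) {s : R} (hs : s ∈ P)
    (hs2 : s ∉ P ^ 2) (n : ℕ) :
    Irreducible (carlitzIter (algebraMap R F s) n + C (algebraMap R F s)) := by
  have hmonic := carlitzIter_add_C_monic s n
  have hirr : Irreducible (carlitzIter s n + C s) :=
    (carlitzIter_add_C_isEisensteinAt hP hs hs2 n).irreducible hP hmonic.isPrimitive
      (by rw [carlitzIter_add_C_natDegree]; positivity)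
  rw [hmonic.irreducible_iff_irreducible_map_fraction_map (K := F)] at hirr
  simpa [carlitzIter_map] using hirr

end Eisenstein

section RationalFunctionField

theorem carlitzIter_ratFunc_irreducible {s : (ZMod 2)[X]} (hs : X ∣ s) (hs2 : ¬ X ^ 2 ∣ s)
    (n : ℕ) :
    Irreducible (carlitzIter (algebraMap _ (RatFunc (ZMod 2)) s) n + C (algebraMap _ _ s)) :=
  carlitzIter_add_C_irreducible (P := Ideal.span {X})
    ((Ideal.span_singleton_prime X_ne_zero).2 prime_X) (Ideal.mem_span_singleton.2 hs)
    (by rwa [Ideal.span_singleton_pow, Ideal.mem_span_singleton]) n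

theorem carlitzIter_ratFunc_X_irreducible (n : ℕ) :
    Irreducible (carlitzIter (RatFunc.X : RatFunc (ZMod 2)) n + C RatFunc.X) := by
  have h2 : ¬ (X ^ 2 : (ZMod 2)[X]) ∣ X := fun h => by
    simpa using natDegree_le_of_dvd h X_ne_zero
  simpa using carlitzIter_ratFunc_irreducible dvd_rfl h2 n

theorem ratFunc_X_ne_sq_add_self (c : RatFunc (ZMod 2)) : c ^ 2 + c ≠ RatFunc.X := by
  intro hc
  have hint : IsIntegral (ZMod 2)[X] c := by
    refine ⟨X ^ 2 + X - C X, by monicity!, ?_⟩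
    simp [hc]
  obtain ⟨p, rfl⟩ := IsIntegrallyClosed.isIntegral_iff.1 hint
  rw [← RatFunc.algebraMap_X, ← map_pow, ← map_add] at hc
  have hp : p * (p + C 1) = X := by
    rw [← RatFunc.algebraMap_injective (ZMod 2) hc, C_1]
    ring
  have hp0 : p ≠ 0 := fun h => X_ne_zero (by rw [← hp, h, zero_mul])
  have hp1 : p + C 1 ≠ 0 := fun h => X_ne_zero (by rw [← hp, h, mul_zero])
  have hdeg := congrArg natDegree hp
  rw [natDegree_mul hp0 hp1, natDegree_add_C, natDegree_X] at hdeg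
  omega

/-- The embedding of `𝔽₂(t)` into `𝔽₂(u)` with `t = u ^ 2 + u`. -/
theorem exists_artinSchreier_embedding :
    ∃ ψ : RatFunc (ZMod 2) →+* RatFunc (ZMod 2),
      ψ RatFunc.X = algebraMap (ZMod 2)[X] _ (X ^ 2 + X) := by
  have hdeg : (X ^ 2 + X : (ZMod 2)[X]).natDegree = 2 := by compute_degree!
  have hinj : Function.Injective (compRingHom (X ^ 2 + X : (ZMod 2)[X])) := by
    rw [injective_iff_map_eq_zero]
    intro p hp
    rcases comp_eq_zero_iff.1 hp with h | h
    · exact h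
    · rw [h.2, natDegree_C] at hdeg
      omega
  refine ⟨IsFractionRing.lift (A := (ZMod 2)[X])
    (g := (algebraMap _ (RatFunc (ZMod 2))).comp (compRingHom (X ^ 2 + X)))
    ((RatFunc.algebraMap_injective _).comp hinj), ?_⟩
  rw [← RatFunc.algebraMap_X, IsFractionRing.lift_algebraMap]
  simp

/-- Adjoining a root of `carlitzIter t n + t` to `𝔽₂(t)` does not split `X ^ 2 + X + t`. -/
theorem sq_add_self_ne_of_mem_adjoin {M : Type*} [Field M] [Algebra (RatFunc (ZMod 2)) M]
    {n : ℕ} {π : M}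
    (hπ : aeval π (carlitzIter (RatFunc.X : RatFunc (ZMod 2)) n + C RatFunc.X) = 0)
    {z : M} (hz : z ∈ IntermediateField.adjoin (RatFunc (ZMod 2)) {π}) :
    z ^ 2 + z ≠ algebraMap (RatFunc (ZMod 2)) M RatFunc.X := by
  intro hzt
  set g := carlitzIter (RatFunc.X : RatFunc (ZMod 2)) n + C RatFunc.X with hg
  have hgm : g.Monic := carlitzIter_add_C_monic RatFunc.X n
  have hgπ : g = minpoly _ π :=
    minpoly.eq_of_irreducible_of_monic (carlitzIter_ratFunc_X_irreducible n) hπ hgm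
  have halg : IsAlgebraic (RatFunc (ZMod 2)) π := ⟨g, hgm.ne_zero, hπ⟩
  rw [← IntermediateField.mem_toSubalgebra,
    IntermediateField.adjoin_simple_toSubalgebra_of_isAlgebraic halg,
    Algebra.adjoin_singleton_eq_range_aeval] at hz
  obtain ⟨q, rfl⟩ := hz
  set p := q %ₘ g with hp
  have hpdeg : p.degree < g.degree := degree_modByMonic_lt q hgm
  have hpq : aeval π p = aeval π q := aeval_modByMonic_eq_self_of_root hπ
  have hdvd : g ∣ p ^ 2 + p - C RatFunc.X := by
    rw [hgπ]
    apply minpoly.dvd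
    have hzt' : aeval π q ^ 2 + aeval π q = algebraMap (RatFunc (ZMod 2)) M RatFunc.X := hzt
    simp [hpq, hzt']
  obtain ⟨ψ, hψ⟩ := exists_artinSchreier_embedding
  have hirr : Irreducible (g.map ψ) := by
    have h2 : ¬ (X ^ 2 : (ZMod 2)[X]) ∣ X ^ 2 + X := fun h => by
      have h1 : (X ^ 2 : (ZMod 2)[X]) ∣ X := (dvd_add_right dvd_rfl).1 h
      simpa using natDegree_le_of_dvd h1 X_ne_zero
    have := carlitzIter_ratFunc_irreducible (s := X ^ 2 + X) ⟨X + 1, by ring⟩ h2 n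
    simpa only [hg, Polynomial.map_add, carlitzIter_map, map_C, hψ] using this
  have hconst (u : RatFunc (ZMod 2)) (hu : g.map ψ ∣ p.map ψ - C u)
      (hu2 : u ^ 2 + u = ψ RatFunc.X) : False := by
    have hpu : p.map ψ - C u = 0 := by
      refine eq_zero_of_dvd_of_degree_lt hu ?_
      refine (degree_sub_le _ _).trans_lt (max_lt ?_ (degree_C_le.trans_lt ?_))
      · rwa [degree_map, degree_map]
      · exact degree_pos_of_irreducible hirr
    have hc : ψ (p.coeff 0) = u := by
      simpa [sub_eq_zero] using congrArg (coeff · 0) hpu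
    refine ratFunc_X_ne_sq_add_self (p.coeff 0) (ψ.injective ?_)
    rw [map_add, map_pow, hc, hu2]
  have hmul : g.map ψ ∣ (p.map ψ - C RatFunc.X) * (p.map ψ - C (RatFunc.X + 1)) := by
    convert Polynomial.map_dvd ψ hdvd using 1
    simp only [Polynomial.map_sub, Polynomial.map_add, Polynomial.map_pow, map_C, hψ, map_add,
      map_pow, RatFunc.algebraMap_X, map_one]
    linear_combination (C RatFunc.X ^ 2 + C RatFunc.X - p.map ψ - C RatFunc.X * p.map ψ) *
      (CharTwo.two_eq_zero (R := (RatFunc (ZMod 2))[X]))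
  have hX : (RatFunc.X : RatFunc (ZMod 2)) ^ 2 + RatFunc.X = ψ RatFunc.X := by
    rw [hψ, map_add, map_pow, RatFunc.algebraMap_X]
  rcases hirr.prime.dvd_or_dvd hmul with h | h
  · exact hconst _ h hX
  · refine hconst _ h (Eq.trans ?_ hX)
    linear_combination (RatFunc.X + 1) * (CharTwo.two_eq_zero (R := RatFunc (ZMod 2)))

end RationalFunctionField

section CarlitzEnd

variable {M : Type*} [Field M] [CharP M 2]

/-- The additive map `x ↦ x ^ 2 + s * x` on a field of characteristic `2`. -/
def carlitzEnd (s : M) : AddMonoid.End M where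
  toFun x := x ^ 2 + s * x
  map_zero' := by simp
  map_add' x y := by rw [CharTwo.add_sq]; ring

theorem carlitzEnd_apply (s x : M) : carlitzEnd s x = x ^ 2 + s * x := rfl

theorem carlitzEnd_eq_zero_iff {s x : M} : carlitzEnd s x = 0 ↔ x = 0 ∨ x = s := by
  rw [carlitzEnd_apply, sq, ← add_mul, mul_eq_zero, CharTwo.add_eq_zero, or_comm]

theorem carlitzEnd_pow_succ_apply (s x : M) (n : ℕ) :
    (carlitzEnd s ^ (n + 1)) x = ((carlitzEnd s ^ n) x) ^ 2 + s * (carlitzEnd s ^ n) x := by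
  rw [pow_succ']
  rfl

theorem eval_carlitzIter (s x : M) (n : ℕ) :
    (carlitzIter s n).eval x = (carlitzEnd s ^ n) x := by
  induction n with
  | zero => simp [carlitzIter]
  | succ n ih => simp [carlitzIter, ih, carlitzEnd_pow_succ_apply]

theorem ncard_carlitzEnd_pow_eq_le (s c : M) (n : ℕ) :
    {x | (carlitzEnd s ^ n) x = c}.ncard ≤ 2 ^ n := by
  classical
  have hd := (carlitzIter_natDegree_monic s n).1
  have hdeg : (carlitzIter s n - C c).natDegree = 2 ^ n := by rw [natDegree_sub_C, hd]
  have h0 : carlitzIter s n - C c ≠ 0 := by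
    intro h
    rw [h, natDegree_zero] at hdeg
    exact (pow_pos two_pos n).ne hdeg
  have hsub : {x | (carlitzEnd s ^ n) x = c} ⊆ ↑(carlitzIter s n - C c).roots.toFinset := by
    intro x hx
    simpa [h0, eval_carlitzIter, sub_eq_zero] using hx
  calc _ ≤ (carlitzIter s n - C c).roots.toFinset.card := by
          rw [← Set.ncard_coe_finset]
          exact Set.ncard_le_ncard hsub
    _ ≤ _ := (Multiset.toFinset_card_le _).trans ((card_roots' _).trans hdeg.le)

theorem ncard_carlitzEnd_pow_eq {s : M} {n : ℕ}
    (h : {x | (carlitzEnd s ^ (n + 1)) x = 0}.ncard = 2 ^ (n + 1)) :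
    {x | (carlitzEnd s ^ n) x = s}.ncard = 2 ^ n := by
  have hunion : {x | (carlitzEnd s ^ (n + 1)) x = 0} =
      {x | (carlitzEnd s ^ n) x = 0} ∪ {x | (carlitzEnd s ^ n) x = s} := by
    ext x
    simp [pow_succ', carlitzEnd_eq_zero_iff]
  have hle := Set.ncard_union_le {x | (carlitzEnd s ^ n) x = 0} {x | (carlitzEnd s ^ n) x = s}
  rw [← hunion, h, pow_succ] at hle
  have h0 := ncard_carlitzEnd_pow_eq_le s 0 n
  have h1 := ncard_carlitzEnd_pow_eq_le s s n
  omega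

end CarlitzEnd

section Iterate

variable {K M : Type*} [Field K] [Field M] [Algebra K M]

theorem polyIter_natDegree {f : K[X]} (n : ℕ) : (polyIter f n).natDegree = f.natDegree ^ n := by
  induction n with
  | zero => simp [polyIter]
  | succ n ih => rw [polyIter, natDegree_comp, ih, pow_succ']

theorem aeval_polyIter_succ (s c : K) (n : ℕ) (x : M) :
    aeval x (polyIter (X ^ 2 + C s * X + C c) (n + 1)) =
      aeval x (polyIter (X ^ 2 + C s * X + C c) n) ^ 2 +
        algebraMap K M s * aeval x (polyIter (X ^ 2 + C s * X + C c) n) + algebraMap K M c := by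
  simp [polyIter]

theorem aeval_polyIter_add_s15 [CharP M 2] (s c : K) (n : ℕ) (x v : M) :
    aeval (x + v) (polyIter (X ^ 2 + C s * X + C c) n) =
      aeval x (polyIter (X ^ 2 + C s * X + C c) n) + (carlitzEnd (algebraMap K M s) ^ n) v := by
  induction n with
  | zero => simp [polyIter]
  | succ n ih =>
    rw [aeval_polyIter_succ, aeval_polyIter_succ, ih, carlitzEnd_pow_succ_apply, CharTwo.add_sq]
    ring

theorem derivative_polyIter [CharP K 2] (s c : K) (n : ℕ) :
    derivative (polyIter (X ^ 2 + C s * X + C c) n) = C (s ^ n) := by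
  induction n with
  | zero => simp [polyIter]
  | succ n ih =>
    simp only [polyIter, add_comp, mul_comp, pow_comp, X_comp, C_comp, derivative_add,
      derivative_mul, derivative_sq, derivative_C, ih, CharTwo.two_eq_zero, C_0]
    simp [pow_succ']

theorem separable_polyIter_s15 [CharP K 2] {s : K} (hs : s ≠ 0) (c : K) (n : ℕ) :
    (polyIter (X ^ 2 + C s * X + C c) n).Separable := by
  rw [separable_def, derivative_polyIter]
  exact ⟨0, C (s ^ n)⁻¹, by
    rw [zero_mul, zero_add, ← C_mul, inv_mul_cancel₀ (pow_ne_zero n hs), C_1]⟩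

theorem algEquiv_carlitzEnd_pow [CharP M 2] (σ : M ≃ₐ[K] M) (s : K) (n : ℕ) (x : M) :
    σ ((carlitzEnd (algebraMap K M s) ^ n) x) = (carlitzEnd (algebraMap K M s) ^ n) (σ x) := by
  induction n with
  | zero => simp
  | succ n ih =>
    rw [carlitzEnd_pow_succ_apply, carlitzEnd_pow_succ_apply, map_add, map_mul, map_pow,
      AlgEquiv.commutes, ih]

/-- A Galois automorphism fixing a generator of the `t ^ (m + 1)`-torsion of the Carlitz module
fixes all of this torsion. -/
theorem algEquiv_apply_eq_of_carlitzEnd [CharP M 2] {s : K} {m : ℕ} {π : M}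
    (hπ : (carlitzEnd (algebraMap K M s) ^ m) π = algebraMap K M s) {σ : M ≃ₐ[K] M}
    (hσ : σ π = π) {k : ℕ} (hk : k ≤ m + 1) {v : M}
    (hv : (carlitzEnd (algebraMap K M s) ^ k) v = 0) : σ v = v := by
  induction k generalizing v with
  | zero =>
    have hv0 : v = 0 := by simpa using hv
    rw [hv0, map_zero]
  | succ k ih =>
    rw [pow_succ', AddMonoid.End.coe_mul, Function.comp_apply, carlitzEnd_eq_zero_iff] at hv
    rcases hv with hv | hv
    · exact ih (by omega) hv
    · set w := (carlitzEnd (algebraMap K M s) ^ (m - k)) π with hw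
      have hσw : σ w = w := by rw [hw, algEquiv_carlitzEnd_pow, hσ]
      have hvw : σ (v + w) = v + w := by
        refine ih (by omega) ?_
        rw [map_add, hv, hw, ← Function.comp_apply (f := ⇑(carlitzEnd (algebraMap K M s) ^ k)),
          ← AddMonoid.End.coe_mul, ← pow_add, Nat.add_sub_cancel' (by omega : k ≤ m), hπ,
          CharTwo.add_self_eq_zero]
      rw [map_add, hσw] at hvw
      exact add_right_cancel hvw

end Iterate

section GaloisGroup

variable {K M : Type*} [Field K] [Field M] [Algebra K M] [CharP M 2]

theorem ncard_carlitzEnd_ker_eq {s c : K} (hs : s ≠ 0) {n : ℕ}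
    [IsSplittingField K M (polyIter (X ^ 2 + C s * X + C c) n)] {β : M}
    (hβ : aeval β (polyIter (X ^ 2 + C s * X + C c) n) = 0) :
    {v | (carlitzEnd (algebraMap K M s) ^ n) v = 0}.ncard = 2 ^ n := by
  have : CharP K 2 := (Algebra.charP_iff K M 2).2 inferInstance
  set p := polyIter (X ^ 2 + C s * X + C c) n with hp
  have hsep : p.Separable := separable_polyIter_s15 hs c n
  have hroots : (fun v => β + v) '' {v | (carlitzEnd (algebraMap K M s) ^ n) v = 0} =
      p.rootSet M := by
    ext x
    simp only [Set.mem_image, Set.mem_ofPred_eq, mem_rootSet, hsep.ne_zero, ne_eq,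
      not_false_eq_true, true_and]
    constructor
    · rintro ⟨v, hv, rfl⟩
      rw [hp, aeval_polyIter_add_s15, hv, ← hp, hβ, add_zero]
    · intro hx
      refine ⟨x - β, ?_, by ring⟩
      rwa [← add_sub_cancel β x, hp, aeval_polyIter_add_s15, ← hp, hβ, zero_add] at hx
  rw [← Set.ncard_image_of_injective _ (add_right_injective β), hroots,
    ← Nat.card_coe_set_eq, Nat.card_eq_fintype_card,
    card_rootSet_eq_natDegree hsep (IsSplittingField.splits M p), hp, polyIter_natDegree]
  congr 1
  compute_degree!

theorem minpoly_eq_of_carlitzEnd {s : K} {m : ℕ} (hirr : Irreducible (carlitzIter s m + C s))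
    {w : M} (hw : (carlitzEnd (algebraMap K M s) ^ m) w = algebraMap K M s) :
    minpoly K w = carlitzIter s m + C s := by
  refine (minpoly.eq_of_irreducible_of_monic hirr ?_ (carlitzIter_add_C_monic s m)).symm
  rw [map_add, aeval_C, aeval_def, eval₂_eq_eval_map, carlitzIter_map, eval_carlitzIter, hw,
    CharTwo.add_self_eq_zero]

theorem exists_algEquiv_apply_eq_of_carlitzEnd [Normal K M] {s : K} {m : ℕ}
    (hirr : Irreducible (carlitzIter s m + C s)) {v w : M}
    (hv : (carlitzEnd (algebraMap K M s) ^ m) v = algebraMap K M s)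
    (hw : (carlitzEnd (algebraMap K M s) ^ m) w = algebraMap K M s) :
    ∃ τ : M ≃ₐ[K] M, τ v = w := by
  rw [← isConjRoot_iff_exists_algEquiv, isConjRoot_def, minpoly_eq_of_carlitzEnd hirr hv,
    minpoly_eq_of_carlitzEnd hirr hw]

theorem orbit_eq_of_carlitzEnd [Normal K M] {s : K} {m : ℕ}
    (hirr : Irreducible (carlitzIter s m + C s)) {π : M}
    (hπ : (carlitzEnd (algebraMap K M s) ^ m) π = algebraMap K M s) :
    MulAction.orbit (M ≃ₐ[K] M) π =
      {w | (carlitzEnd (algebraMap K M s) ^ m) w = algebraMap K M s} := by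
  ext w
  constructor
  · rintro ⟨σ, rfl⟩
    change (carlitzEnd (algebraMap K M s) ^ m) (σ π) = _
    rw [← algEquiv_carlitzEnd_pow, hπ, AlgEquiv.commutes]
  · exact exists_algEquiv_apply_eq_of_carlitzEnd hirr hπ

theorem carlitzEnd_pow_add_eq_zero {s c : K} {n : ℕ} {β : M}
    (hβ : aeval β (polyIter (X ^ 2 + C s * X + C c) n) = 0) (σ : M ≃ₐ[K] M) :
    (carlitzEnd (algebraMap K M s) ^ n) (β + σ β) = 0 := by
  have h := aeval_polyIter_add_s15 s c n β (β + σ β)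
  rwa [← add_assoc, CharTwo.add_self_eq_zero, zero_add, hβ, zero_add, aeval_algEquiv,
    AlgHom.comp_apply, hβ, map_zero, eq_comm] at h

/-- If an automorphism `σ` fixing the generator `π` of the torsion moves the root `β` by a
generator of the torsion, then the automorphisms fixing `π` move `β` by every torsion element. -/
theorem exists_mem_stabilizer_apply_eq_add [Normal K M] {s : K}
    {m : ℕ} (hirr : Irreducible (carlitzIter s m + C s)) {π β v₀ : M}
    (hπ : (carlitzEnd (algebraMap K M s) ^ m) π = algebraMap K M s)
    (hβ : ∀ σ : M ≃ₐ[K] M, (carlitzEnd (algebraMap K M s) ^ (m + 1)) (β + σ β) = 0)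
    (hv₀ : (carlitzEnd (algebraMap K M s) ^ m) v₀ = algebraMap K M s)
    (hσ₀ : ∃ σ ∈ MulAction.stabilizer (M ≃ₐ[K] M) π, σ β = β + v₀) {v : M}
    (hv : (carlitzEnd (algebraMap K M s) ^ (m + 1)) v = 0) :
    ∃ σ ∈ MulAction.stabilizer (M ≃ₐ[K] M) π, σ β = β + v := by
  obtain ⟨σ, hσ, hσβ⟩ := hσ₀
  have hker {w : M} (hw : (carlitzEnd (algebraMap K M s) ^ m) w = algebraMap K M s) :
      (carlitzEnd (algebraMap K M s) ^ (m + 1)) w = 0 := by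
    rw [pow_succ', AddMonoid.End.coe_mul, Function.comp_apply, hw, carlitzEnd_eq_zero_iff]
    exact Or.inr rfl
  have hfix {ρ : M ≃ₐ[K] M} (hρ : ρ ∈ MulAction.stabilizer (M ≃ₐ[K] M) π) {w : M}
      (hw : (carlitzEnd (algebraMap K M s) ^ (m + 1)) w = 0) : ρ w = w :=
    algEquiv_apply_eq_of_carlitzEnd hπ hρ le_rfl hw
  have hgen {w : M} (hw : (carlitzEnd (algebraMap K M s) ^ m) w = algebraMap K M s) :
      ∃ ρ ∈ MulAction.stabilizer (M ≃ₐ[K] M) π, ρ β = β + w := by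
    obtain ⟨τ, rfl⟩ := exists_algEquiv_apply_eq_of_carlitzEnd hirr hv₀ hw
    refine ⟨τ * σ * τ⁻¹, ?_, ?_⟩
    · rw [MulAction.mem_stabilizer_iff, AlgEquiv.smul_def, AlgEquiv.mul_apply, AlgEquiv.mul_apply,
        hfix hσ, ← AlgEquiv.mul_apply, mul_inv_cancel, AlgEquiv.one_apply]
      rw [← algEquiv_carlitzEnd_pow, hker hπ, map_zero]
    · have hτ : σ (β + τ⁻¹ β) = β + τ⁻¹ β := hfix hσ (hβ _)
      rw [map_add, hσβ, add_assoc, add_right_inj] at hτ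
      have hτ' : σ (τ⁻¹ β) = v₀ + τ⁻¹ β := by
        conv_rhs => rw [← hτ, ← add_assoc, CharTwo.add_self_eq_zero, zero_add]
      rw [AlgEquiv.mul_apply, AlgEquiv.mul_apply, hτ', map_add, ← AlgEquiv.mul_apply τ τ⁻¹,
        mul_inv_cancel, AlgEquiv.one_apply, add_comm]
  have hv' := hv
  rw [pow_succ', AddMonoid.End.coe_mul, Function.comp_apply, carlitzEnd_eq_zero_iff] at hv'
  rcases hv' with hv' | hv'
  · obtain ⟨ρ, hρ, hρβ⟩ := hgen (w := v + v₀) (by rw [map_add, hv', hv₀, zero_add])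
    refine ⟨ρ * σ, mul_mem hρ hσ, ?_⟩
    rw [AlgEquiv.mul_apply, hσβ, map_add, hρβ, hfix hρ (hker hv₀), ← add_assoc, add_assoc,
      CharTwo.add_self_eq_zero, add_zero]
  · exact hgen hv'

theorem card_stabilizer_eq {s c : K} (hs : s ≠ 0) {m : ℕ}
    [IsSplittingField K M (polyIter (X ^ 2 + C s * X + C c) (m + 1))] [Normal K M]
    (hirr : Irreducible (carlitzIter s m + C s)) {π β v₀ : M}
    (hπ : (carlitzEnd (algebraMap K M s) ^ m) π = algebraMap K M s)
    (hβ : aeval β (polyIter (X ^ 2 + C s * X + C c) (m + 1)) = 0)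
    (hv₀ : (carlitzEnd (algebraMap K M s) ^ m) v₀ = algebraMap K M s)
    (hσ₀ : ∃ σ ∈ MulAction.stabilizer (M ≃ₐ[K] M) π, σ β = β + v₀) :
    Nat.card (MulAction.stabilizer (M ≃ₐ[K] M) π) = 2 ^ (m + 1) := by
  rw [← ncard_carlitzEnd_ker_eq hs hβ, ← Nat.card_coe_set_eq]
  refine Nat.card_congr (Equiv.ofBijective
    (fun σ => ⟨β + σ.1 β, carlitzEnd_pow_add_eq_zero hβ σ.1⟩) ⟨fun σ ρ h => ?_, fun v => ?_⟩)
  · have hσρ : σ.1 β = ρ.1 β := add_left_cancel (congrArg Subtype.val h)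
    refine Subtype.ext (AlgEquiv.coe_toAlgHom_injective
      (AlgHom.ext_of_adjoin_eq_top (IsSplittingField.adjoin_rootSet M
        (polyIter (X ^ 2 + C s * X + C c) (m + 1))) fun x hx => ?_))
    have hx' : (carlitzEnd (algebraMap K M s) ^ (m + 1)) (x - β) = 0 := by
      have h := aeval_polyIter_add_s15 s c (m + 1) β (x - β)
      rwa [add_sub_cancel, hβ, zero_add, aeval_eq_zero_of_mem_rootSet hx, eq_comm] at h
    have hfix (τ : MulAction.stabilizer (M ≃ₐ[K] M) π) : τ.1 x = τ.1 β + (x - β) := by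
      rw [← algEquiv_apply_eq_of_carlitzEnd hπ τ.2 le_rfl hx', ← map_add, add_sub_cancel]
    simp only [AlgEquiv.coe_toAlgHom]
    rw [hfix, hfix, hσρ]
  · obtain ⟨σ, hσ, hσβ⟩ := exists_mem_stabilizer_apply_eq_add hirr hπ
      (carlitzEnd_pow_add_eq_zero hβ) hv₀ hσ₀ v.2
    refine ⟨⟨σ, hσ⟩, Subtype.ext ?_⟩
    simp only [hσβ]
    rw [← add_assoc, CharTwo.add_self_eq_zero, zero_add]

end GaloisGroup

/-- Some automorphism fixing the generator `π` of the torsion moves the root `β` by a generator. -/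
theorem exists_mem_stabilizer_carlitzEnd_pow_eq {M : Type*} [Field M] [Algebra (RatFunc (ZMod 2)) M]
    [CharP M 2] [FiniteDimensional (RatFunc (ZMod 2)) M] [IsGalois (RatFunc (ZMod 2)) M] {m : ℕ}
    {π β : M}
    (hπ : (carlitzEnd (algebraMap (RatFunc (ZMod 2)) M RatFunc.X) ^ m) π =
      algebraMap (RatFunc (ZMod 2)) M RatFunc.X)
    (hβ : aeval β (polyIter (X ^ 2 + C (RatFunc.X : RatFunc (ZMod 2)) * X + C (RatFunc.X ^ 3))
      (m + 1)) = 0) :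
    ∃ σ ∈ MulAction.stabilizer (M ≃ₐ[RatFunc (ZMod 2)] M) π,
      (carlitzEnd (algebraMap (RatFunc (ZMod 2)) M RatFunc.X) ^ m) (β + σ β) =
        algebraMap (RatFunc (ZMod 2)) M RatFunc.X := by
  by_contra! hne
  set t := algebraMap (RatFunc (ZMod 2)) M RatFunc.X with ht
  have ht0 : t ≠ 0 := by simp [ht, RatFunc.X_ne_zero]
  set z := aeval β
    (polyIter (X ^ 2 + C (RatFunc.X : RatFunc (ZMod 2)) * X + C (RatFunc.X ^ 3)) m) with hz
  have hz0 : z ^ 2 + t * z + t ^ 3 = 0 := by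
    rw [← hβ, aeval_polyIter_succ, map_pow (algebraMap _ _)]
  have hzfix : ∀ σ ∈ MulAction.stabilizer (M ≃ₐ[RatFunc (ZMod 2)] M) π, σ z = z := by
    intro σ hσ
    have h := carlitzEnd_pow_add_eq_zero hβ σ
    rw [pow_succ', AddMonoid.End.coe_mul, Function.comp_apply, carlitzEnd_eq_zero_iff,
      or_iff_left (hne σ hσ)] at h
    have hadd := aeval_polyIter_add_s15 (RatFunc.X : RatFunc (ZMod 2)) (RatFunc.X ^ 3) m β (β + σ β)
    rw [h, add_zero, ← add_assoc, CharTwo.add_self_eq_zero, zero_add, aeval_algEquiv] at hadd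
    exact hadd
  have hmem : z ∈ IntermediateField.adjoin (RatFunc (ZMod 2)) {π} := by
    rw [← IsGalois.fixedField_fixingSubgroup (IntermediateField.adjoin (RatFunc (ZMod 2)) {π}),
      IntermediateField.mem_fixedField_iff]
    intro σ hσ
    refine hzfix σ ?_
    rw [IntermediateField.mem_fixingSubgroup_iff] at hσ
    exact hσ π (IntermediateField.mem_adjoin_simple_self _ π)
  refine sq_add_self_ne_of_mem_adjoin (z := z / t) (n := m) (π := π) ?_
    (div_mem hmem (IntermediateField.algebraMap_mem _ _)) ?_
  · rw [map_add, aeval_C, aeval_def, eval₂_eq_eval_map, carlitzIter_map, eval_carlitzIter, hπ,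
      CharTwo.add_self_eq_zero]
  · rw [← ht, ← CharTwo.add_eq_zero]
    field_simp
    linear_combination hz0

/-- Let `K = 𝔽₂(t)` and `f = x² + tx + t³ ∈ K[x]`. Then for every `n ≥ 1`
the splitting field of `f^n` over `K` has degree `2^(2n−1)`, i.e. the dynamical Galois
group of `f` is all of `Φ_∞ ≅ 𝔽₂[[y]] ⋊ 𝔽₂[[y]]^×`. -/
theorem stmt15 :
    ∀ n : ℕ, 1 ≤ n →
      Module.finrank (RatFunc (ZMod 2))
        (SplittingField
          (polyIter
            (X ^ 2 + C (RatFunc.X : RatFunc (ZMod 2)) * X +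
              C ((RatFunc.X : RatFunc (ZMod 2)) ^ 3)) n)) =
      2 ^ (2 * n - 1) := by
  intro n hn
  obtain ⟨m, rfl⟩ := Nat.exists_eq_add_of_le' hn
  set p := polyIter (X ^ 2 + C (RatFunc.X : RatFunc (ZMod 2)) * X +
    C ((RatFunc.X : RatFunc (ZMod 2)) ^ 3)) (m + 1) with hp
  have hX : (RatFunc.X : RatFunc (ZMod 2)) ≠ 0 := RatFunc.X_ne_zero
  have hirr := carlitzIter_ratFunc_X_irreducible m
  have hsep : p.Separable := separable_polyIter_s15 hX _ _
  have : IsGalois (RatFunc (ZMod 2)) p.SplittingField :=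
    IsGalois.of_separable_splitting_field hsep
  have : CharP p.SplittingField 2 := (Algebra.charP_iff (RatFunc (ZMod 2)) _ 2).1 inferInstance
  obtain ⟨β, hβ⟩ : ∃ β : p.SplittingField, aeval β p = 0 := by
    have hdeg : (p.map (algebraMap _ p.SplittingField)).degree ≠ 0 := by
      have hp1 : p.natDegree = 2 ^ (m + 1) := by
        rw [hp, polyIter_natDegree]
        congr 1
        compute_degree!
      rw [degree_map]
      refine (natDegree_pos_iff_degree_pos.1 ?_).ne'
      rw [hp1]
      positivity
    obtain ⟨β, hβ⟩ := (SplittingField.splits p).exists_eval_eq_zero hdeg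
    exact ⟨β, by rwa [aeval_def, eval₂_eq_eval_map]⟩
  have hW := ncard_carlitzEnd_pow_eq (ncard_carlitzEnd_ker_eq hX hβ)
  obtain ⟨π, hπ⟩ : Set.Nonempty {w | (carlitzEnd (algebraMap _ p.SplittingField RatFunc.X) ^ m) w =
      algebraMap (RatFunc (ZMod 2)) _ RatFunc.X} := by
    refine Set.nonempty_of_ncard_ne_zero ?_
    rw [hW]
    positivity
  obtain ⟨σ, hσ, hv⟩ := exists_mem_stabilizer_carlitzEnd_pow_eq hπ hβ
  have hstab := card_stabilizer_eq hX hirr hπ hβ hv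
    ⟨σ, hσ, by rw [← add_assoc, CharTwo.add_self_eq_zero, zero_add]⟩
  rw [← IsGalois.card_aut_eq_finrank, ← (MulAction.stabilizer _ π).card_mul_index, hstab,
    MulAction.index_stabilizer, orbit_eq_of_carlitzEnd hirr hπ, hW, ← pow_add]
  congr 1
  omega
end

section
/- Fix a prime p and q = p^r. Let K be an 𝔽_q-field, let K(t,s) be the rational function field in two independent variables over K, and let f̃ = x^q + tx + s ∈ K(t,s)[x]. Fix an algebraic closure Ω of K(t,s) and let F_n ⊆ Ω be the splitting field of L^n over K(t,s), where L = x^q + tx. Then for every n ≥ 1 the polynomial f̃^n (the n-fold composition) is irreducible in F_n[x]. -/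
open Polynomial

set_option synthInstance.maxHeartbeats 1000000
set_option maxHeartbeats 1000000

theorem polyIter_eq_iterate {K : Type*} [Field K] (f : K[X]) (n : ℕ) :
    polyIter f n = f.comp^[n] X := by
  induction n with
  | zero => rfl
  | succ n ih => rw [Function.iterate_succ_apply', polyIter, ih]

theorem Polynomial.map_iterate_comp_X {R S : Type*} [CommSemiring R] [CommSemiring S]
    (φ : R →+* S) (f : R[X]) (n : ℕ) :
    (f.comp^[n] X).map φ = (f.map φ).comp^[n] X := by
  induction n with
  | zero => simp
  | succ n ih => rw [Function.iterate_succ_apply', Function.iterate_succ_apply', map_comp, ih]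

/-- If `f` is monic of positive degree over a domain, so are its iterates. -/
theorem Polynomial.Monic.iterate_comp_X {R : Type*} [CommRing R] [IsDomain R] {f : R[X]}
    (hf : f.Monic) (hd : f.natDegree ≠ 0) (n : ℕ) :
    (f.comp^[n] X).Monic ∧ (f.comp^[n] X).natDegree ≠ 0 := by
  induction n with
  | zero => simp [monic_X]
  | succ n ih =>
    rw [Function.iterate_succ_apply', natDegree_comp]
    exact ⟨hf.comp ih.1 ih.2, mul_ne_zero hd ih.2⟩

theorem Polynomial.monic_X_pow_add_C_mul_X_add_C {R : Type*} [CommRing R] [Nontrivial R]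
    {q : ℕ} (hq : 1 < q) (a b : R) :
    (X ^ q + C a * X + C b : R[X]).Monic ∧ (X ^ q + C a * X + C b : R[X]).natDegree ≠ 0 := by
  have hdeg : (C a * X + C b : R[X]).degree < q :=
    degree_linear_le.trans_lt (by exact_mod_cast hq)
  rw [add_assoc]
  refine ⟨monic_X_pow_add hdeg, ?_⟩
  have h : (X ^ q + (C a * X + C b) : R[X]).natDegree = q := by
    rw [natDegree_add_eq_left_of_degree_lt (by rwa [degree_X_pow]), natDegree_X_pow]
  omega

/-- The automorphism of `R[S][X]` over `R` given by `S ↦ S + X - X ^ q - t X`, `X ↦ X`. -/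
noncomputable def shiftEquiv {R : Type*} [CommRing R] (q : ℕ) (t : R) : R[X][X] ≃ₐ[R] R[X][X] :=
  (Bivariate.swap.trans
    ((algEquivAevalXAddC (X - X ^ q - C t * X : R[X])).restrictScalars R)).trans Bivariate.swap

theorem shiftEquiv_X {R : Type*} [CommRing R] (q : ℕ) (t : R) :
    shiftEquiv q t X = X := by
  simp [shiftEquiv, Bivariate.swap_apply, algEquivAevalXAddC]

theorem shiftEquiv_C_X {R : Type*} [CommRing R] (q : ℕ) (t : R) :
    shiftEquiv q t (C X) = C X + (X - X ^ q - C (C t) * X) := by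
  simp [shiftEquiv, Bivariate.swap_apply, algEquivAevalXAddC]

theorem shiftEquiv_C_C {R : Type*} [CommRing R] (q : ℕ) (t a : R) :
    shiftEquiv q t (C (C a)) = C (C a) :=
  (shiftEquiv q t).commutes a

/-- The automorphism `shiftEquiv` straightens the iterates of `X ^ q + t X + S`. -/
theorem exists_shiftEquiv_iterate_eq {R : Type*} [CommRing R] (p r : ℕ) [Fact p.Prime]
    [CharP R p] (t : R) (n : ℕ) :
    ∃ a : R[X], shiftEquiv (p ^ r) t
      ((X ^ p ^ r + C (C t) * X + C X : R[X][X]).comp^[n] X) = X + C a := by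
  induction n with
  | zero => exact ⟨0, by simp [shiftEquiv_X]⟩
  | succ n ih =>
    obtain ⟨a, ha⟩ := ih
    refine ⟨a ^ p ^ r + C t * a + X, ?_⟩
    rw [Function.iterate_succ_apply']
    simp only [add_comp, mul_comp, pow_comp, X_comp, C_comp, map_add, map_mul, map_pow, ha,
      shiftEquiv_C_C, shiftEquiv_C_X, add_pow_char_pow]
    ring

theorem irreducible_iterate_comp_polynomial {R : Type*} [CommRing R] [IsDomain R] (p r : ℕ)
    [Fact p.Prime] [CharP R p] (t : R) (n : ℕ) :
    Irreducible ((X ^ p ^ r + C (C t) * X + C X : R[X][X]).comp^[n] X) := by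
  obtain ⟨a, ha⟩ := exists_shiftEquiv_iterate_eq p r t n
  rw [← MulEquiv.irreducible_iff (shiftEquiv (p ^ r) t), ha]
  exact (monic_X_add_C a).irreducible_of_degree_eq_one (degree_X_add_C a)

/-- The iterates of `X ^ q + t X + S` are irreducible over the fraction field of `R[S]`. -/
theorem irreducible_iterate_comp_fractionRing {R M : Type*} [Field R] [Field M]
    [Algebra R[X] M] [IsFractionRing R[X] M] (p r : ℕ) (hr : r ≠ 0)
    [Fact p.Prime] [CharP R p] (t : R) (n : ℕ) :
    Irreducible ((X ^ p ^ r + C (algebraMap R[X] M (C t)) * X +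
      C (algebraMap R[X] M X) : M[X]).comp^[n] X) := by
  have hq : 1 < p ^ r := Nat.one_lt_pow hr (Fact.out : p.Prime).one_lt
  obtain ⟨hm, hd⟩ := monic_X_pow_add_C_mul_X_add_C hq (C t) (X : R[X])
  have h := ((hm.iterate_comp_X hd n).1.irreducible_iff_irreducible_map_fraction_map
    (K := M)).mp (irreducible_iterate_comp_polynomial p r t n)
  rw [map_iterate_comp_X] at h
  simpa using h

theorem irreducible_map_of_algHom {F L M : Type*} [Field F] [Field L] [Field M] [Algebra F L]
    [Algebra F M] (σ : L →ₐ[F] M) {f : F[X]} (hf : f.Monic)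
    (hirr : Irreducible (f.map (algebraMap F M))) : Irreducible (f.map (algebraMap F L)) := by
  refine Monic.irreducible_of_irreducible_map (σ : L →+* M) _ (hf.map _) ?_
  rwa [Polynomial.map_map, σ.comp_algebraMap]

theorem nonempty_algHom_adjoin_rootSet {F M Ω : Type*} [Field F] [Field M] [Field Ω]
    [Algebra F M] [Algebra F Ω] {g : F[X]} (hg : (g.map (algebraMap F M)).Splits) :
    Nonempty (IntermediateField.adjoin F (g.rootSet Ω) →ₐ[F] M) := by
  refine IntermediateField.nonempty_algHom_adjoin_of_splits fun x hx ↦ ?_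
  obtain ⟨h0, hx⟩ := mem_rootSet'.mp hx
  have hg0 : g ≠ 0 := fun h ↦ h0 (by rw [h, Polynomial.map_zero])
  have hx' : IsAlgebraic F x := ⟨g, hg0, hx⟩
  exact ⟨hx'.isIntegral, hg.of_dvd (Polynomial.map_ne_zero hg0)
    (Polynomial.map_dvd (algebraMap F M) (minpoly.dvd F x hx))⟩

theorem exists_injective_ringHom_polynomial (K : Type*) [Field K] :
    ∃ φ : MvPolynomial (Fin 2) K →+*
        (AlgebraicClosure (FractionRing (MvPolynomial (Fin 1) K)))[X],
      Function.Injective φ ∧ (∃ a, φ (MvPolynomial.X 0) = C a) ∧ φ (MvPolynomial.X 1) = X := by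
  let ι := algebraMap (MvPolynomial (Fin 1) K)
    (AlgebraicClosure (FractionRing (MvPolynomial (Fin 1) K)))
  have hι : Function.Injective ι := by
    have h := (algebraMap (FractionRing (MvPolynomial (Fin 1) K))
      (AlgebraicClosure (FractionRing (MvPolynomial (Fin 1) K)))).injective.comp
      (IsFractionRing.injective (MvPolynomial (Fin 1) K) (FractionRing (MvPolynomial (Fin 1) K)))
    rwa [← RingHom.coe_comp, ← IsScalarTower.algebraMap_eq] at h
  let e := (MvPolynomial.renameEquiv K (Equiv.swap (0 : Fin 2) 1)).trans
    (MvPolynomial.finSuccEquiv K 1)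
  refine ⟨(mapRingHom ι).comp (e : _ →+* _), (map_injective ι hι).comp e.injective,
    ⟨ι (MvPolynomial.X 0), ?_⟩, ?_⟩
  · have : e (MvPolynomial.X 0) = C (MvPolynomial.X 0) := by
      simp [e, ← MvPolynomial.finSuccEquiv_X_succ]
    simp [this]
  · have : e (MvPolynomial.X 1) = X := by
      simp [e, ← MvPolynomial.finSuccEquiv_X_zero]
    simp [this]

/-- Let `q = p^r`, `K` an `𝔽_q`-field, `K(t,s)` the rational function
field in two variables, `f̃ = x^q + tx + s`, `L = x^q + tx`, `Ω` an algebraic closure of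
`K(t,s)`, and `F_n ⊆ Ω` the splitting field of `L^n` over `K(t,s)`. Then for every
`n ≥ 1` the polynomial `f̃^n` is irreducible over `F_n`. -/
theorem stmt17 (p r : ℕ) [Fact p.Prime] (hr : 1 ≤ r) (q : ℕ) (hq : q = p ^ r)
    (K : Type*) [Field K] [Algebra (GaloisField p r) K] (n : ℕ) (hn : 1 ≤ n) :
    let Kts := FractionRing (MvPolynomial (Fin 2) K)
    let t : Kts := algebraMap (MvPolynomial (Fin 2) K) Kts (MvPolynomial.X 0)
    let s : Kts := algebraMap (MvPolynomial (Fin 2) K) Kts (MvPolynomial.X 1)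
    let Ω := AlgebraicClosure Kts
    let Fn := IntermediateField.adjoin Kts ((polyIter (X ^ q + C t * X : Kts[X]) n).rootSet Ω)
    Irreducible ((polyIter (X ^ q + C t * X + C s : Kts[X]) n).map (algebraMap Kts ↥Fn)) := by
  intro Kts t s Ω Fn
  subst hq
  have hq1 : 1 < p ^ r := Nat.one_lt_pow (by omega) (Fact.out : p.Prime).one_lt
  let E := AlgebraicClosure (FractionRing (MvPolynomial (Fin 1) K))
  have : CharP K p := charP_of_injective_algebraMap
    (algebraMap (GaloisField p r) K).injective p
  have : CharP E p := charP_of_injective_algebraMap (algebraMap K E).injective p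
  obtain ⟨φ, hφ, ⟨a, h0⟩, h1⟩ := exists_injective_ringHom_polynomial K
  let M := FractionRing E[X]
  have hψ : Function.Injective ((algebraMap E[X] M).comp φ) :=
    (IsFractionRing.injective E[X] M).comp hφ
  let ψ : Kts →+* M := IsFractionRing.lift hψ
  have ht : ψ t = algebraMap E[X] M (C a) := by
    rw [← h0]; exact IsFractionRing.lift_algebraMap hψ _
  have hs : ψ s = algebraMap E[X] M X := by
    rw [← h1]; exact IsFractionRing.lift_algebraMap hψ _
  let _ : Algebra Kts M := ψ.toAlgebra
  have hmap : algebraMap Kts M = ψ := rfl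
  obtain ⟨hm, hd⟩ := monic_X_pow_add_C_mul_X_add_C hq1 t s
  have hL : ((polyIter (X ^ p ^ r + C t * X : Kts[X]) n).map (algebraMap Kts M)).Splits := by
    have h := (IsAlgClosed.splits ((X ^ p ^ r + C a * X : E[X]).comp^[n] X)).map
      ((algebraMap E[X] M).comp C)
    rw [map_iterate_comp_X] at h
    rw [polyIter_eq_iterate, map_iterate_comp_X, hmap]
    simpa [ht] using h
  obtain ⟨σ⟩ := nonempty_algHom_adjoin_rootSet (Ω := Ω) hL
  apply irreducible_map_of_algHom σ
  · rw [polyIter_eq_iterate]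
    exact (hm.iterate_comp_X hd n).1
  · rw [polyIter_eq_iterate, map_iterate_comp_X, hmap]
    simpa [ht, hs] using irreducible_iterate_comp_fractionRing (M := M) p r (by omega) a n
end
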